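/- arXiv:2206.04493 — 2 statements merged into one kernel-verified Lean document; each statement's English description precedes it below -/
import Mathlib

section
/- Let (J,𝓑,η) be a (k,p)-loose Markov space and G=(U,W,E) a bigraph with deg(w)≤k for all w∈W and deg(u)≤p for all u∈U. Then η^G = η^{G*}: the measure on J^{U∪W} defined by integrating over J^U the product of the star-disintegration measures ψ attached to the nodes of W coincides with the measure defined by integrating over J^W the product of the ψ measures attached to the nodes of U (i.e., η^G(∏_{u∈U}A_u × ∏_{w∈W}B_w) = ∫_{∏_{w}B_w} ∏_{u∈U} ψ_{y|_{N(u)}}(A_u) dπ^W(y) for all Borel boxes). -/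
open MeasureTheory ProbabilityTheory Finset Filter
open scoped ENNReal

variable {J : Type*} [MeasurableSpace J]

/-- The joint law `σ_k` of `k` independent single steps of the kernel `P`, started from a
common `π`-random point; here the steps are indexed by an arbitrary finite type `ι`. -/
noncomputable def stepMeasureIdx (π : Measure J) (P : Kernel J J) (ι : Type*) [Fintype ι] :
    Measure (ι → J) :=
  π.bind fun x => Measure.pi fun _ : ι => P x

/-- The density `s_ι = dσ_ι/dπ^ι`. -/
noncomputable def stepDensityIdx (π : Measure J) (P : Kernel J J) (ι : Type*) [Fintype ι] :
    (ι → J) → ℝ≥0∞ :=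
  (stepMeasureIdx π P ι).rnDeriv (Measure.pi fun _ : ι => π)

/-- `k`-looseness: `σ_k ≪ π^k`. -/
def KLoose (π : Measure J) (P : Kernel J J) (k : ℕ) : Prop :=
  stepMeasureIdx π P (Fin k) ≪ Measure.pi fun _ : Fin k => π

/-- `(k,p)`-looseness: `k`-loose and `s_k ∈ L^p(π^k)`. -/
def KPLoose (π : Measure J) (P : Kernel J J) (k p : ℕ) : Prop :=
  KLoose π P k ∧
    ∫⁻ x, stepDensityIdx π P (Fin k) x ^ p ∂(Measure.pi fun _ : Fin k => π) < ⊤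

section Bigraph

variable {U W' : Type*} [Fintype U] [Fintype W'] [DecidableEq U] [DecidableEq W']

/-- Neighbourhood in `U` of a right vertex `w` of a bigraph with edge set `E ⊆ U × W`. -/
def nbrW (E : Finset (U × W')) (w : W') : Finset U :=
  Finset.univ.filter fun u => (u, w) ∈ E

/-- Neighbourhood in `W` of a left vertex `u` of a bigraph with edge set `E ⊆ U × W`. -/
def nbrU (E : Finset (U × W')) (u : U) : Finset W' :=
  Finset.univ.filter fun w => (u, w) ∈ E

/-- `ψ` is a *star disintegration family* for `(π, P)` over the finite index type `ι`:
a measurable family `(ψ_x : x ∈ J^ι)` of finite measures on `J` with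
`∫_A ψ_x(B) dπ^ι(x) = ∫_B P_y^{⊗ι}(A) dπ(y)` for all measurable `A ⊆ J^ι`, `B ⊆ J`.
Informally, `ψ_x` is the measure on common neighbours of the points `x i`. -/
def IsStarDisint (π : Measure J) (P : Kernel J J) {ι : Type*} [Fintype ι]
    (ψ : Kernel (ι → J) J) : Prop :=
  (∀ x, IsFiniteMeasure (ψ x)) ∧
  ∀ (A : Set (ι → J)) (B : Set J), MeasurableSet A → MeasurableSet B →
    ∫⁻ x in A, ψ x B ∂(Measure.pi fun _ : ι => π)
      = ∫⁻ y in B, (Measure.pi fun _ : ι => P y) A ∂π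

/-- The homomorphism measure `η^G` on `J^U × J^W` of a bigraph `G = (U, W, E)`, built from a
star disintegration family `ψ`: the points of `U` are i.i.d. `π`-points `x`, and the points
`w ∈ W` are then independent with "distributions" `ψ_w (x|_{N(w)})`.  On boxes,
`η^G(∏ A_u × ∏ B_w) = ∫_{∏ A_u} ∏_w ψ_{x|N(w)}(B_w) dπ^U(x)`. -/
noncomputable def homMeasure (π : Measure J) (E : Finset (U × W'))
    (ψ : ∀ w : W', Kernel (↥(nbrW E w) → J) J) : Measure ((U → J) × (W' → J)) :=
  (Measure.pi fun _ : U => π).bind fun x =>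
    (Measure.dirac x).prod (Measure.pi fun w : W' => ψ w fun u => x u.1)

/-- The `1`-regular step graphon of the Markov space `η` associated with the finite partition
encoded by the classifying map `c : J → Fin mm`: its value at `(a, b)` is
`η(P(a) × P(b)) / (π(P(a)) π(P(b)))` where `P(z)` is the partition class of `z`. -/
noncomputable def stepW (η : Measure (J × J)) {mm : ℕ} (c : J → Fin mm) (a b : J) : ℝ≥0∞ :=
  η ((c ⁻¹' {c a}) ×ˢ (c ⁻¹' {c b})) /
    ((η.map Prod.fst) (c ⁻¹' {c a}) * (η.map Prod.fst) (c ⁻¹' {c b}))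

/-- The value of the homomorphism measure `η_𝒫^G = (W_𝒫)^G ⬝ π^V` of the bigraph
`G = (U, W, E)` in the step graphon of the partition `c`, on the box `∏ A_u × ∏ B_w`. -/
noncomputable def stepBoxVal (η : Measure (J × J)) {mm : ℕ} (c : J → Fin mm)
    (E : Finset (U × W')) (A : U → Set J) (B : W' → Set J) : ℝ≥0∞ :=
  ∫⁻ x : U → J in Set.univ.pi A,
    ∫⁻ y : W' → J in Set.univ.pi B,
      ∏ e ∈ E, stepW η c (x e.1) (y e.2)
    ∂(Measure.pi fun _ : W' => η.map Prod.fst) ∂(Measure.pi fun _ : U => η.map Prod.fst)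

end Bigraph

/-- The distance `|a - b|` on `ℝ≥0∞`, written with truncated subtraction. -/
noncomputable def absDiff (a b : ℝ≥0∞) : ℝ≥0∞ := max (a - b) (b - a)

theorem absDiff_le_iff {a b d : ℝ≥0∞} : absDiff a b ≤ d ↔ a ≤ b + d ∧ b ≤ a + d := by
  simp only [absDiff, max_le_iff, tsub_le_iff_left]

theorem le_add_absDiff (a b : ℝ≥0∞) : a ≤ b + absDiff a b := (absDiff_le_iff.1 le_rfl).1

theorem absDiff_comm (a b : ℝ≥0∞) : absDiff a b = absDiff b a := max_comm _ _

theorem absDiff_triangle (a b c : ℝ≥0∞) : absDiff a c ≤ absDiff a b + absDiff b c := by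
  rw [absDiff_le_iff]
  constructor
  · calc a ≤ b + absDiff a b := le_add_absDiff a b
      _ ≤ (c + absDiff b c) + absDiff a b := by gcongr; exact le_add_absDiff b c
      _ = _ := by ring
  · calc c ≤ b + absDiff c b := le_add_absDiff c b
      _ ≤ (a + absDiff b a) + absDiff c b := by gcongr; exact le_add_absDiff b a
      _ = _ := by rw [absDiff_comm b a, absDiff_comm c b]; ring

@[simp] theorem absDiff_self (a : ℝ≥0∞) : absDiff a a = 0 := by simp [absDiff]

theorem Measurable.absDiff {X : Type*} [MeasurableSpace X] {f g : X → ℝ≥0∞}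
    (hf : Measurable f) (hg : Measurable g) : Measurable fun x => absDiff (f x) (g x) :=
  (hf.sub hg).max (hg.sub hf)

theorem absDiff_ofReal_le (r s : ℝ) (hr : 0 ≤ r) :
    absDiff (ENNReal.ofReal r) (ENNReal.ofReal s) ≤ ‖r - s‖ₑ := by
  rw [absDiff_le_iff, Real.enorm_eq_ofReal_abs]
  constructor
  · refine (ENNReal.ofReal_le_ofReal ?_).trans ENNReal.ofReal_add_le
    linarith [le_abs_self (r - s)]
  · rw [← ENNReal.ofReal_add hr (abs_nonneg _)]
    exact ENNReal.ofReal_le_ofReal (by linarith [neg_abs_le (r - s)])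

section CellAverage

variable {X : Type*} [MeasurableSpace X]

/-- The average of `f` over the fibre of the classifying map `c` that contains `x`. -/
noncomputable def cellAvg {D : Type*} (μ : Measure X) (c : X → D) (f : X → ℝ≥0∞) (x : X) : ℝ≥0∞ :=
  (μ (c ⁻¹' {c x}))⁻¹ * ∫⁻ z in c ⁻¹' {c x}, f z ∂μ

theorem eLpNorm_natCast_eq (μ : Measure X) (f : X → ℝ≥0∞) {p : ℕ} (hp : 1 ≤ p) :
    eLpNorm f p μ = (∫⁻ x, f x ^ p ∂μ) ^ (1 / (p : ℝ)) := by
  rw [eLpNorm_eq_lintegral_rpow_enorm_toReal (by positivity) (by simp)]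
  simp

theorem eLpNorm_natCast_lt_top_iff (μ : Measure X) (f : X → ℝ≥0∞) {p : ℕ} (hp : 1 ≤ p) :
    eLpNorm f p μ < ⊤ ↔ ∫⁻ x, f x ^ p ∂μ < ⊤ := by
  rw [eLpNorm_natCast_eq μ f hp, ENNReal.rpow_lt_top_iff_of_pos (by positivity)]

theorem lintegral_pow_le (ν : Measure X) [IsFiniteMeasure ν] {f : X → ℝ≥0∞} (hf : Measurable f)
    {p : ℕ} (hp : 1 ≤ p) :
    (∫⁻ x, f x ∂ν) ^ p ≤ (∫⁻ x, f x ^ p ∂ν) * ν Set.univ ^ (p - 1) := by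
  have hp0 : (0 : ℝ) < p := by positivity
  have h := eLpNorm'_le_eLpNorm'_mul_rpow_measure_univ (μ := ν) (p := 1) (q := p) one_pos
    (by exact_mod_cast hp) hf.aestronglyMeasurable
  simp only [eLpNorm', enorm_eq_self, ENNReal.rpow_one, one_div, inv_one, ENNReal.rpow_natCast] at h
  calc (∫⁻ x, f x ∂ν) ^ p
      ≤ ((∫⁻ x, f x ^ p ∂ν) ^ (p : ℝ)⁻¹ * ν Set.univ ^ (1 - (p : ℝ)⁻¹)) ^ p := by gcongr
    _ = _ := by
        rw [mul_pow, ← ENNReal.rpow_natCast, ← ENNReal.rpow_mul, ← ENNReal.rpow_natCast (_ ^ _) p,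
          ← ENNReal.rpow_mul, inv_mul_cancel₀ hp0.ne', ENNReal.rpow_one, sub_mul,
          inv_mul_cancel₀ hp0.ne', one_mul, ← ENNReal.rpow_natCast _ (p - 1), Nat.cast_sub hp]
        simp

variable {D : Type*} (μ : Measure X) {c : X → D}

theorem absDiff_cellAvg_le {f g : X → ℝ≥0∞} (hf : Measurable f) (hg : Measurable g)
    (x : X) : absDiff (cellAvg μ c f x) (cellAvg μ c g x) ≤
      cellAvg μ c (fun z => absDiff (f z) (g z)) x := by
  rw [absDiff_le_iff]
  simp only [cellAvg]
  rw [← mul_add, ← mul_add, ← lintegral_add_left hf, ← lintegral_add_left hg]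
  constructor
  · gcongr with z; exact le_add_absDiff _ _
  · gcongr with z; rw [absDiff_comm]; exact le_add_absDiff _ _

theorem ae_class_measure_ne_zero [Finite D] : ∀ᵐ x ∂μ, μ (c ⁻¹' {c x}) ≠ 0 := by
  cases nonempty_fintype D
  rw [ae_iff]
  simp only [ne_eq, not_not]
  have : {x | μ (c ⁻¹' {c x}) = 0} = ⋃ d ∈ {d | μ (c ⁻¹' {d}) = 0}, c ⁻¹' {d} := by
    ext; simp
  rw [this, measure_biUnion_null_iff (Set.to_countable _)]
  exact fun d hd => hd

variable [MeasurableSpace D] [DiscreteMeasurableSpace D]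

theorem measurable_comp_class (hc : Measurable c) (F : D → ℝ≥0∞) : Measurable fun x => F (c x) :=
  (Measurable.of_discrete (f := F)).comp hc

theorem measurable_cellAvg (hc : Measurable c) (f : X → ℝ≥0∞) : Measurable (cellAvg μ c f) :=
  measurable_comp_class hc fun d => (μ (c ⁻¹' {d}))⁻¹ * ∫⁻ z in c ⁻¹' {d}, f z ∂μ

theorem setLIntegral_class (hc : Measurable c) (F : D → ℝ≥0∞) (d : D) :
    ∫⁻ x in c ⁻¹' {d}, F (c x) ∂μ = F d * μ (c ⁻¹' {d}) := by
  rw [setLIntegral_congr_fun (g := fun _ => F d) (hc (measurableSet_singleton d))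
    fun x (hx : c x = d) => by rw [hx]]
  simp

variable [Finite D]

theorem lintegral_eq_sum_class [Fintype D] (hc : Measurable c) (f : X → ℝ≥0∞) :
    ∫⁻ x, f x ∂μ = ∑ d, ∫⁻ x in c ⁻¹' {d}, f x ∂μ := by
  rw [← lintegral_biUnion_finset _ fun d _ => hc (measurableSet_singleton d)]
  · have : ⋃ d ∈ (Finset.univ : Finset D), c ⁻¹' {d} = Set.univ := by ext; simp
    rw [this, Measure.restrict_univ]
  · intro a _ b _ hab
    exact Disjoint.preimage c (by simpa using hab)

theorem lintegral_cellAvg_pow_le [IsProbabilityMeasure μ] (hc : Measurable c) {f : X → ℝ≥0∞}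
    (hf : Measurable f) (p : ℕ) :
    ∫⁻ x, cellAvg μ c f x ^ p ∂μ ≤ ∫⁻ x, f x ^ p ∂μ := by
  cases nonempty_fintype D
  rcases Nat.eq_zero_or_pos p with rfl | hp
  · simp
  rw [lintegral_eq_sum_class μ hc, lintegral_eq_sum_class μ hc (fun x => f x ^ p)]
  refine Finset.sum_le_sum fun d _ => ?_
  have hcell : ∫⁻ x in c ⁻¹' {d}, cellAvg μ c f x ^ p ∂μ =
      ((μ (c ⁻¹' {d}))⁻¹ * ∫⁻ z in c ⁻¹' {d}, f z ∂μ) ^ p * μ (c ⁻¹' {d}) :=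
    setLIntegral_class μ hc (fun d => ((μ (c ⁻¹' {d}))⁻¹ * ∫⁻ z in c ⁻¹' {d}, f z ∂μ) ^ p) d
  rw [hcell]
  set m := μ (c ⁻¹' {d})
  rcases eq_or_ne m 0 with h0 | h0
  · simp [h0]
  have ht : m ≠ ⊤ := measure_ne_top _ _
  have := lintegral_pow_le (μ.restrict (c ⁻¹' {d})) hf hp
  rw [Measure.restrict_apply_univ] at this
  calc (m⁻¹ * ∫⁻ z in c ⁻¹' {d}, f z ∂μ) ^ p * m
      ≤ (m⁻¹) ^ p * ((∫⁻ z in c ⁻¹' {d}, f z ^ p ∂μ) * m ^ (p - 1)) * m := by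
        rw [mul_pow]; gcongr
    _ = (m⁻¹ * m) ^ p * ∫⁻ z in c ⁻¹' {d}, f z ^ p ∂μ := by
        conv_rhs => rw [mul_pow, ← Nat.sub_add_cancel hp, pow_succ m]
        rw [Nat.sub_add_cancel hp]; ring
    _ = _ := by rw [ENNReal.inv_mul_cancel h0 ht, one_pow, one_mul]

theorem eLpNorm_cellAvg_le [IsProbabilityMeasure μ] (hc : Measurable c) {f : X → ℝ≥0∞}
    (hf : Measurable f) {p : ℕ} (hp : 1 ≤ p) : eLpNorm (cellAvg μ c f) p μ ≤ eLpNorm f p μ := by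
  rw [eLpNorm_natCast_eq μ _ hp, eLpNorm_natCast_eq μ _ hp]
  exact ENNReal.rpow_le_rpow (lintegral_cellAvg_pow_le μ hc hf p) (by positivity)

theorem cellAvg_of_class [IsProbabilityMeasure μ] (hc : Measurable c) (F : D → ℝ≥0∞) :
    cellAvg μ c (fun x => F (c x)) =ᵐ[μ] fun x => F (c x) := by
  filter_upwards [ae_class_measure_ne_zero μ (c := c)] with x hx
  rw [cellAvg, setLIntegral_class μ hc, mul_left_comm,
    ENNReal.inv_mul_cancel hx (measure_ne_top _ _), mul_one]

end CellAverage

section Refining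

variable {X : Type*} [mX : MeasurableSpace X] {I : Type*} [SemilatticeSup I]
  {D : I → Type*} [∀ n, MeasurableSpace (D n)]

/-- A directed family of classifying maps that become finer along `I` and jointly generate the
σ-algebra of `X`. -/
structure IsRefining (c : ∀ n : I, X → D n) : Prop where
  measurable : ∀ n, Measurable (c n)
  refine : ∀ ⦃n m⦄, n ≤ m → ∀ ⦃x y⦄, c m x = c m y → c n x = c n y
  generate : ∀ 𝓜 : MeasurableSpace X, (∀ n (S : Set (D n)), MeasurableSet[𝓜] (c n ⁻¹' S)) →
    mX ≤ 𝓜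

namespace IsRefining

variable {c : ∀ n : I, X → D n}

theorem exists_factor (hc : IsRefining c) {n m : I} (h : n ≤ m) {α : Type*} [Nonempty α]
    (F : D n → α) : ∃ G : D m → α, ∀ x, F (c n x) = G (c m x) := by
  have : Function.FactorsThrough (fun x => F (c n x)) (c m) := fun x y hxy => by
    simp only [hc.refine h hxy]
  exact ⟨_, fun x => (this.extend_apply (fun _ => Classical.arbitrary α) x).symm⟩

theorem isSetAlgebra [Nonempty I] (hc : IsRefining c) :
    IsSetAlgebra {s | ∃ n S, s = c n ⁻¹' S} where
  empty_mem := ⟨Classical.arbitrary I, ∅, by simp⟩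
  compl_mem := by
    rintro _ ⟨n, S, rfl⟩
    exact ⟨n, Sᶜ, rfl⟩
  union_mem := by
    rintro _ _ ⟨n, S, rfl⟩ ⟨m, T, rfl⟩
    obtain ⟨S', hS'⟩ := hc.exists_factor (le_sup_left : n ≤ n ⊔ m) (· ∈ S)
    obtain ⟨T', hT'⟩ := hc.exists_factor (le_sup_right : m ≤ n ⊔ m) (· ∈ T)
    refine ⟨n ⊔ m, {d | S' d ∨ T' d}, ?_⟩
    ext x
    simp only [Set.mem_union, Set.mem_preimage, Set.mem_ofPred_eq, ← hS', ← hT']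

variable [Nonempty I] [∀ n, DiscreteMeasurableSpace (D n)] (μ : Measure X)
  [IsProbabilityMeasure μ]

theorem measureDense (hc : IsRefining c) : μ.MeasureDense {s | ∃ n S, s = c n ⁻¹' S} := by
  refine Measure.MeasureDense.of_generateFrom_isSetAlgebra_finite μ hc.isSetAlgebra ?_
  refine le_antisymm ?_ ?_
  · refine hc.generate _ fun n S => MeasurableSpace.measurableSet_generateFrom ?_
    exact ⟨n, S, rfl⟩
  refine MeasurableSpace.generateFrom_le ?_
  rintro _ ⟨n, S, rfl⟩
  exact hc.measurable n (.of_discrete)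

theorem exists_step_approx (hc : IsRefining c) {p : ℕ} (hp : 1 ≤ p) {f : X → ℝ}
    (hf : MemLp f p μ) {ε : ℝ≥0∞} (hε : ε ≠ 0) :
    ∃ (n : I) (F : D n → ℝ), eLpNorm (f - fun x => F (c n x)) p μ ≤ ε := by
  have hp0 : (p : ℝ≥0∞) ≠ 0 := by positivity
  suffices ∃ g, eLpNorm (f - g) p μ ≤ ε ∧ ∃ (n : I) (F : D n → ℝ), g = fun x => F (c n x) by
    obtain ⟨g, hg, n, F, rfl⟩ := this
    exact ⟨n, F, hg⟩
  refine MemLp.induction_dense (by simp)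
    (fun g : X → ℝ => ∃ (n : I) (F : D n → ℝ), g = fun x => F (c n x)) ?_ ?_ ?_ hf hε
  · intro a s hs hμs ε hε
    obtain ⟨η, hη0, hη⟩ := exists_eLpNorm_indicator_le (μ := μ) (p := p) (by simp) a hε
    obtain ⟨t, ⟨n, S, rfl⟩, ht⟩ := (hc.measureDense μ).approx s hs hμs.ne η (by exact_mod_cast hη0)
    refine ⟨_, ?_, n, S.indicator fun _ => a, rfl⟩
    refine le_trans (le_of_eq ?_) (hη (symmDiff s (c n ⁻¹' S)) ?_)
    · refine eLpNorm_congr_norm_ae (.of_forall fun x => ?_)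
      by_cases h1 : x ∈ s <;> by_cases h2 : c n x ∈ S <;>
        simp [Set.indicator, Set.mem_symmDiff, h1, h2]
    · refine ht.le.trans (by simp)
  · rintro _ _ ⟨n, F, rfl⟩ ⟨m, G, rfl⟩
    obtain ⟨F', hF'⟩ := hc.exists_factor (le_sup_left : n ≤ n ⊔ m) F
    obtain ⟨G', hG'⟩ := hc.exists_factor (le_sup_right : m ≤ n ⊔ m) G
    exact ⟨n ⊔ m, F' + G', by ext x; simp [hF', hG']⟩
  · rintro _ ⟨n, F, rfl⟩
    exact ((Measurable.of_discrete (f := F)).comp (hc.measurable n)).aestronglyMeasurable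

/-- Functions in `L^p` are approximated by step functions with finite values. -/
theorem exists_step_approx_ennreal (hc : IsRefining c) {p : ℕ} (hp : 1 ≤ p) {f : X → ℝ≥0∞}
    (hf : Measurable f) (hfp : eLpNorm f p μ < ⊤) {ε : ℝ≥0∞} (hε : ε ≠ 0) :
    ∃ (n : I) (G : D n → NNReal),
      eLpNorm (fun x => absDiff (f x) (G (c n x))) p μ ≤ ε := by
  have hfin : ∀ᵐ x ∂μ, f x ≠ ⊤ := by
    have h := ae_lt_top (hf.pow_const p) ((eLpNorm_natCast_lt_top_iff μ f hp).1 hfp).ne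
    filter_upwards [h] with x hx hx'
    simp [hx', Nat.one_le_iff_ne_zero.1 hp] at hx
  have hmem : MemLp (fun x => (f x).toReal) p μ := by
    refine ⟨hf.ennreal_toReal.aestronglyMeasurable, lt_of_le_of_lt ?_ hfp⟩
    refine eLpNorm_mono_enorm fun x => ?_
    simp only [enorm_eq_self, Real.enorm_eq_ofReal ENNReal.toReal_nonneg]
    exact ENNReal.ofReal_toReal_le
  obtain ⟨j, F, hF⟩ := hc.exists_step_approx μ hp hmem hε
  refine ⟨j, fun d => (F d).toNNReal, le_trans (eLpNorm_mono_enorm_ae ?_) hF⟩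
  filter_upwards [hfin] with x hx
  have := absDiff_ofReal_le (f x).toReal (F (c j x)) ENNReal.toReal_nonneg
  rwa [ENNReal.ofReal_toReal hx] at this

variable [∀ n, Finite (D n)]

/-- Cell averages along a refining family converge in `L^p`. -/
theorem tendsto_eLpNorm_absDiff (hc : IsRefining c) {p : ℕ} (hp : 1 ≤ p) {f : X → ℝ≥0∞}
    (hf : Measurable f) (hfp : eLpNorm f p μ < ⊤) :
    Tendsto (fun n => eLpNorm (fun x => absDiff (cellAvg μ (c n) f x) (f x)) p μ) atTop
      (nhds 0) := by
  have hp1 : (1 : ℝ≥0∞) ≤ p := by exact_mod_cast hp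
  rw [ENNReal.tendsto_nhds_zero]
  intro ε hε
  obtain ⟨j, F, hfg⟩ := hc.exists_step_approx_ennreal μ hp hf hfp (ε := ε / 2)
    (by simpa using hε.ne')
  set g : X → ℝ≥0∞ := fun x => F (c j x)
  have hg : Measurable g := measurable_comp_class (hc.measurable j) fun d => F d
  filter_upwards [eventually_ge_atTop j] with n hn
  have hcn := hc.measurable n
  have hAf := measurable_cellAvg μ hcn f
  have hAg := measurable_cellAvg μ hcn g
  obtain ⟨G, hG⟩ := hc.exists_factor hn fun d => (F d : ℝ≥0∞)
  have hgG : g = fun x => G (c n x) := funext hG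
  have hzero : ∀ᵐ x ∂μ, absDiff (cellAvg μ (c n) g x) (g x) = 0 := by
    rw [hgG]
    filter_upwards [cellAvg_of_class μ hcn G] with x hx
    rw [hx, absDiff_self]
  calc eLpNorm (fun x => absDiff (cellAvg μ (c n) f x) (f x)) p μ
      ≤ eLpNorm ((cellAvg μ (c n) fun z => absDiff (f z) (g z)) +
          fun x => absDiff (f x) (g x)) p μ := by
        refine eLpNorm_mono_enorm_ae ?_
        filter_upwards [hzero] with x hx
        simp only [enorm_eq_self, Pi.add_apply]
        calc _ ≤ absDiff (cellAvg μ (c n) f x) (cellAvg μ (c n) g x) +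
              absDiff (cellAvg μ (c n) g x) (f x) := absDiff_triangle _ _ _
          _ ≤ absDiff (cellAvg μ (c n) f x) (cellAvg μ (c n) g x) +
              (absDiff (cellAvg μ (c n) g x) (g x) + absDiff (g x) (f x)) := by
            gcongr; exact absDiff_triangle _ _ _
          _ ≤ _ := by
            rw [hx, zero_add, absDiff_comm (g x)]
            gcongr
            exact absDiff_cellAvg_le μ hf hg x
    _ ≤ eLpNorm (cellAvg μ (c n) fun z => absDiff (f z) (g z)) p μ +
          eLpNorm (fun x => absDiff (f x) (g x)) p μ :=
        eLpNorm_add_le (measurable_cellAvg μ hcn _).aestronglyMeasurable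
          (hf.absDiff hg).aestronglyMeasurable hp1
    _ ≤ ε / 2 + ε / 2 := by
        gcongr
        exact (eLpNorm_cellAvg_le μ hcn (hf.absDiff hg) hp).trans hfg
    _ = ε := ENNReal.add_halves ε

end IsRefining

theorem absDiff_toReal_le (a b : ℝ≥0∞) (ha : a ≠ ⊤) (hb : b ≠ ⊤) :
    ‖a.toReal - b.toReal‖ₑ ≤ absDiff a b := by
  lift a to NNReal using ha
  lift b to NNReal using hb
  simp only [absDiff, ENNReal.coe_toReal, Real.enorm_eq_ofReal_abs]
  rcases le_total a b with h | h
  · rw [abs_of_nonpos (by simpa using h)]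
    refine le_max_of_le_right (le_of_eq ?_)
    rw [neg_sub, ← NNReal.coe_sub h, ENNReal.ofReal_coe_nnreal, ENNReal.coe_sub]
  · rw [abs_of_nonneg (by simpa using h)]
    refine le_max_of_le_left (le_of_eq ?_)
    rw [← NNReal.coe_sub h, ENNReal.ofReal_coe_nnreal, ENNReal.coe_sub]

theorem IsRefining.exists_seq_tendsto_ae {D : ℕ → Type*} [∀ n, MeasurableSpace (D n)]
    [∀ n, Finite (D n)] [∀ n, DiscreteMeasurableSpace (D n)] {c : ∀ n, X → D n}
    (hc : IsRefining c) (μ : Measure X) [IsProbabilityMeasure μ] {f : X → ℝ≥0∞}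
    (hf : Measurable f) (hf1 : ∫⁻ x, f x ∂μ < ⊤) :
    ∃ ns : ℕ → ℕ, ∀ᵐ x ∂μ, Tendsto (fun i => cellAvg μ (c (ns i)) f x) atTop (nhds (f x)) := by
  have hL1 := hc.tendsto_eLpNorm_absDiff μ le_rfl hf
    ((eLpNorm_natCast_lt_top_iff μ f le_rfl).2 (by simpa using hf1))
  have hfin : ∀ᵐ x ∂μ, f x < ⊤ := ae_lt_top hf hf1.ne
  have hafin : ∀ᵐ x ∂μ, ∀ n, cellAvg μ (c n) f x < ⊤ := by
    refine ae_all_iff.2 fun n => ae_lt_top (measurable_cellAvg μ (hc.measurable n) f) ?_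
    have := lintegral_cellAvg_pow_le μ (hc.measurable n) hf 1
    simp only [pow_one] at this
    exact (this.trans_lt hf1).ne
  have hL1' : Tendsto (fun n => eLpNorm ((fun x => (cellAvg μ (c n) f x).toReal) -
      fun x => (f x).toReal) 1 μ) atTop (nhds 0) := by
    refine tendsto_of_tendsto_of_tendsto_of_le_of_le tendsto_const_nhds hL1
      (fun _ => zero_le) fun n => ?_
    rw [Nat.cast_one]
    refine eLpNorm_mono_enorm_ae ?_
    filter_upwards [hfin, hafin] with x hx hxa
    exact absDiff_toReal_le _ _ (hxa n).ne hx.ne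
  obtain ⟨ns, -, hns⟩ := (tendstoInMeasure_of_tendsto_eLpNorm one_ne_zero
    (fun n => (measurable_cellAvg μ (hc.measurable n) f).ennreal_toReal.aestronglyMeasurable)
    hf.ennreal_toReal.aestronglyMeasurable hL1').exists_seq_tendsto_ae
  refine ⟨ns, ?_⟩
  filter_upwards [hfin, hafin, hns] with x hx hxa h
  exact (ENNReal.tendsto_toReal_iff (fun i => (hxa _).ne) hx.ne).1 h

/-- Lower semicontinuity: an integrable function whose averages are bounded in `L^p` is bounded
in `L^p`. -/
theorem IsRefining.lintegral_pow_le_of_cellAvg {D : ℕ → Type*} [∀ n, MeasurableSpace (D n)]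
    [∀ n, Finite (D n)] [∀ n, DiscreteMeasurableSpace (D n)] {c : ∀ n, X → D n}
    (hc : IsRefining c) (μ : Measure X) [IsProbabilityMeasure μ] {f : X → ℝ≥0∞}
    (hf : Measurable f) (hf1 : ∫⁻ x, f x ∂μ < ⊤) (p : ℕ) {K : ℝ≥0∞}
    (hK : ∀ n, ∫⁻ x, cellAvg μ (c n) f x ^ p ∂μ ≤ K) : ∫⁻ x, f x ^ p ∂μ ≤ K := by
  obtain ⟨ns, hns⟩ := hc.exists_seq_tendsto_ae μ hf hf1
  calc ∫⁻ x, f x ^ p ∂μ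
      = ∫⁻ x, liminf (fun i => cellAvg μ (c (ns i)) f x ^ p) atTop ∂μ := by
        refine lintegral_congr_ae ?_
        filter_upwards [hns] with x hx
        exact (((ENNReal.continuous_pow p).tendsto _).comp hx).liminf_eq.symm
    _ ≤ liminf (fun i => ∫⁻ x, cellAvg μ (c (ns i)) f x ^ p ∂μ) atTop :=
        lintegral_liminf_le fun i => (measurable_cellAvg μ (hc.measurable _) f).pow_const p
    _ ≤ K := by
        refine (liminf_le_liminf (v := fun _ => K) (.of_forall fun i => hK _)).trans ?_
        simp

end Refining

section Bits

variable [MeasurableSpace.CountablyGenerated J]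

/-- Membership of a point in the first `n` sets of a generating sequence of `J`. -/
def bits (n : ℕ) (x : J) : Fin n → Prop := fun i => x ∈ MeasurableSpace.natGeneratingSequence J i

/-- The classifying map of the product partition of `J^ι` with level `n i` in coordinate `i`. -/
def boxBits {ι : Type*} (n : ι → ℕ) (x : ι → J) : ∀ i, Fin (n i) → Prop := fun i => bits (n i) (x i)

theorem measurable_bits (n : ℕ) : Measurable (bits (J := J) n) :=
  measurable_pi_lambda _ fun _ => (MeasurableSpace.measurableSet_natGeneratingSequence _).mem

theorem bits_congr {n m : ℕ} (h : n ≤ m) {x y : J} (hxy : bits m x = bits m y) :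
    bits n x = bits n y :=
  funext fun i => congrFun hxy (Fin.castLE h i)

variable {ι : Type*}

theorem measurable_boxBits (n : ι → ℕ) : Measurable (boxBits (J := J) n) :=
  measurable_pi_lambda _ fun i => (measurable_bits (n i)).comp (measurable_pi_apply i)

theorem boxBits_congr {n m : ι → ℕ} (h : n ≤ m) {x y : ι → J} (hxy : boxBits m x = boxBits m y) :
    boxBits n x = boxBits n y :=
  funext fun i => bits_congr (h i) (congrFun hxy i)

theorem isRefining_bits : IsRefining (bits (J := J)) where
  measurable := measurable_bits
  refine _ _ h _ _ := bits_congr h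
  generate := by
    have hJ := (MeasurableSpace.generateFrom_natGeneratingSequence J).symm
    intro 𝓜 h𝓜
    refine hJ.trans_le (MeasurableSpace.generateFrom_le ?_)
    rintro _ ⟨m, rfl⟩
    exact h𝓜 (m + 1) {d | d (Fin.last m)}

theorem isRefining_boxBits_const : IsRefining fun j : ℕ => boxBits (J := J) fun _ : ι => j where
  measurable _ := measurable_boxBits _
  refine _ _ h _ _ := boxBits_congr fun _ => h
  generate := by
    have hJ := (MeasurableSpace.generateFrom_natGeneratingSequence J).symm
    intro 𝓜 h𝓜
    refine iSup_le fun i => ?_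
    rw [hJ, MeasurableSpace.comap_generateFrom]
    refine MeasurableSpace.generateFrom_le ?_
    rintro _ ⟨_, ⟨m, rfl⟩, rfl⟩
    exact h𝓜 (m + 1) {d | d i (Fin.last m)}

theorem isRefining_boxBits : IsRefining (boxBits (J := J) (ι := ι)) where
  measurable := measurable_boxBits
  refine _ _ h _ _ := boxBits_congr h
  generate := by
    have h := (isRefining_boxBits_const (J := J) (ι := ι)).generate
    exact fun 𝓜 h𝓜 => h 𝓜 fun j => h𝓜 fun _ => j

/-- The cell of level `n` that contains `x`. -/
def bitCell (n : ℕ) (x : J) : Set J := bits n ⁻¹' {bits n x}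

theorem measurableSet_bitCell (n : ℕ) (x : J) : MeasurableSet (bitCell n x) :=
  measurable_bits n (measurableSet_singleton _)

theorem boxBits_preimage_singleton (n : ι → ℕ) (x : ι → J) :
    boxBits n ⁻¹' {boxBits n x} = Set.univ.pi fun i => bitCell (n i) (x i) := by
  ext y
  simp [boxBits, bitCell, funext_iff]

variable [Fintype ι] (π : Measure J) [IsProbabilityMeasure π]

theorem cellAvg_boxBits (n : ι → ℕ) (f : (ι → J) → ℝ≥0∞) (x : ι → J) :
    cellAvg (Measure.pi fun _ : ι => π) (boxBits n) f x =
      (∏ i, (π (bitCell (n i) (x i)))⁻¹) *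
        ∫⁻ z in Set.univ.pi fun i => bitCell (n i) (x i), f z ∂Measure.pi fun _ => π := by
  rw [cellAvg, boxBits_preimage_singleton, Measure.pi_pi, ENNReal.prod_inv_distrib]
  intro i _ j _ _
  exact .inr (measure_ne_top _ _)

theorem ae_bitCell_ne_zero (n : ι → ℕ) :
    ∀ᵐ x ∂(Measure.pi fun _ : ι => π), ∀ i, π (bitCell (n i) (x i)) ≠ 0 := by
  filter_upwards [ae_class_measure_ne_zero (Measure.pi fun _ : ι => π) (c := boxBits n)] with x hx
  rw [boxBits_preimage_singleton, Measure.pi_pi] at hx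
  exact fun i => Finset.prod_ne_zero_iff.1 hx i (Finset.mem_univ i)

end Bits

section Products

variable {ι κ : Type*}

theorem setLIntegral_pi_prod [Fintype ι] (π : Measure J) [IsProbabilityMeasure π] {A : ι → Set J}
    (hA : ∀ i, MeasurableSet (A i)) {f : ι → J → ℝ≥0∞} (hf : ∀ i, Measurable (f i)) :
    ∫⁻ x in Set.univ.pi A, ∏ i, f i (x i) ∂(Measure.pi fun _ : ι => π) =
      ∏ i, ∫⁻ x in A i, f i x ∂π := by
  have hg : ∀ i, Measurable ((A i).indicator (f i)) := fun i => (hf i).indicator (hA i)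
  have hind := iIndepFun_pi (μ := fun _ : ι => π) (X := fun i => (A i).indicator (f i))
    fun i => (hg i).aemeasurable
  have h := lintegral_prod_eq_prod_lintegral_of_indepFun Finset.univ _ hind
    fun i => (hg i).comp (measurable_pi_apply i)
  calc _ = ∫⁻ x, ∏ i, (A i).indicator (f i) (x i) ∂(Measure.pi fun _ : ι => π) := by
        rw [← lintegral_indicator (MeasurableSet.univ_pi hA)]
        refine lintegral_congr fun x => ?_
        by_cases hx : x ∈ Set.univ.pi A
        · rw [Set.indicator_of_mem hx]
          exact Finset.prod_congr rfl fun i _ => (Set.indicator_of_mem (hx i trivial) _).symm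
        · rw [Set.indicator_of_notMem hx]
          simp only [Set.mem_univ_pi, not_forall] at hx
          obtain ⟨i, hi⟩ := hx
          exact (Finset.prod_eq_zero (Finset.mem_univ i) (Set.indicator_of_notMem hi _)).symm
    _ = _ := by
        rw [h]
        refine Finset.prod_congr rfl fun i _ => ?_
        rw [← lintegral_indicator (hA i)]
        exact (measurePreserving_eval (fun _ : ι => π) i).lintegral_comp (hg i)

/-- The Tonelli theorem for a product over the edges of a finite bipartite graph. -/
theorem lintegral_prod_lintegral_comm [Fintype ι] [Fintype κ] (π : Measure J)
    [IsProbabilityMeasure π] {N : κ → Finset ι} {M : ι → Finset κ}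
    (hNM : ∀ i l, i ∈ N l ↔ l ∈ M i) {V : ι → J → J → ℝ≥0∞}
    (hV : ∀ i, Measurable (Function.uncurry (V i))) {A : ι → Set J} (hA : ∀ i, MeasurableSet (A i))
    {B : κ → Set J} (hB : ∀ l, MeasurableSet (B l)) :
    ∫⁻ x in Set.univ.pi A, ∏ l, ∫⁻ y in B l, ∏ i ∈ N l, V i (x i) y ∂π
        ∂(Measure.pi fun _ : ι => π) =
      ∫⁻ y in Set.univ.pi B, ∏ i, ∫⁻ x in A i, ∏ l ∈ M i, V i x (y l) ∂π
        ∂(Measure.pi fun _ : κ => π) := by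
  have hV1 : ∀ i y, Measurable fun x => V i x y := fun i y =>
    (hV i).comp (measurable_id.prodMk measurable_const)
  have hV2 : ∀ i x, Measurable fun y => V i x y := fun i x =>
    (hV i).comp (measurable_const.prodMk measurable_id)
  have hL : ∀ x : ι → J, ∏ l, ∫⁻ y in B l, ∏ i ∈ N l, V i (x i) y ∂π =
      ∫⁻ y in Set.univ.pi B, ∏ l, ∏ i ∈ N l, V i (x i) (y l) ∂(Measure.pi fun _ : κ => π) :=
    fun x => (setLIntegral_pi_prod π hB fun l =>
      Finset.measurable_fun_prod (N l) fun i _ => hV2 i (x i)).symm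
  have hR : ∀ y : κ → J, ∏ i, ∫⁻ x in A i, ∏ l ∈ M i, V i x (y l) ∂π =
      ∫⁻ x in Set.univ.pi A, ∏ i, ∏ l ∈ M i, V i (x i) (y l) ∂(Measure.pi fun _ : ι => π) :=
    fun y => (setLIntegral_pi_prod π hA fun i =>
      Finset.measurable_fun_prod (M i) fun l _ => hV1 i (y l)).symm
  simp_rw [hL, hR]
  rw [lintegral_lintegral_swap]
  · refine lintegral_congr fun y => lintegral_congr fun x => ?_
    exact Finset.prod_comm' fun l i => by simp [hNM]
  · refine Measurable.aemeasurable ?_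
    refine Finset.measurable_fun_prod _ fun l _ => Finset.measurable_fun_prod _ fun i _ => ?_
    have h : Measurable fun z : (ι → J) × (κ → J) => (z.1 i, z.2 l) := by fun_prop
    exact (hV i).comp h

/-- A product changes by at most a telescoping sum when its factors change. -/
theorem prod_le_prod_add_sum [DecidableEq κ] (s : Finset κ) {a b δ : κ → ℝ≥0∞}
    (h : ∀ i ∈ s, a i ≤ b i + δ i) :
    ∏ i ∈ s, a i ≤ ∏ i ∈ s, b i + ∑ i ∈ s, δ i * ∏ j ∈ s.erase i, (a j + b j) := by
  induction s using Finset.induction with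
  | empty => simp
  | insert i s hi ih =>
    have ih' := ih fun j hj => h j (Finset.mem_insert_of_mem hj)
    rw [Finset.prod_insert hi, Finset.prod_insert hi, Finset.sum_insert hi,
      Finset.erase_insert hi]
    have hsum : ∀ j ∈ s, ∏ l ∈ (insert i s).erase j, (a l + b l) =
        (a i + b i) * ∏ l ∈ s.erase j, (a l + b l) := fun j hj => by
      rw [Finset.erase_insert_of_ne (by rintro rfl; exact hi hj),
        Finset.prod_insert fun h' => hi (Finset.mem_of_mem_erase h')]
    rw [Finset.sum_congr rfl fun j hj => by rw [hsum j hj]]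
    calc a i * ∏ j ∈ s, a j
        ≤ (b i + δ i) * ∏ j ∈ s, a j := by gcongr; exact h i (Finset.mem_insert_self i s)
      _ = b i * ∏ j ∈ s, a j + δ i * ∏ j ∈ s, a j := add_mul _ _ _
      _ ≤ b i * (∏ j ∈ s, b j + ∑ j ∈ s, δ j * ∏ l ∈ s.erase j, (a l + b l)) +
            δ i * ∏ j ∈ s, (a j + b j) := by
          gcongr
          exact le_self_add
      _ ≤ b i * ∏ j ∈ s, b j + (a i + b i) * (∑ j ∈ s, δ j * ∏ l ∈ s.erase j, (a l + b l)) +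
            δ i * ∏ j ∈ s, (a j + b j) := by
          rw [mul_add]
          gcongr
          exact le_add_self
      _ = _ := by
          rw [Finset.mul_sum, add_assoc, add_comm (Finset.sum _ _)]
          congr 2
          exact Finset.sum_congr rfl fun j _ => by ring

/-- The Finner inequality for lower marginals. -/
theorem lmarginal_prod_rpow_le [DecidableEq ι] [Fintype κ] (π : Measure J) [IsProbabilityMeasure π]
    {N : κ → Finset ι} {p : ℕ} (hp : 1 ≤ p)
    (hN : ∀ i, (Finset.univ.filter fun l => i ∈ N l).card ≤ p) {f : κ → (ι → J) → ℝ≥0∞}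
    (hf : ∀ l, Measurable (f l)) (hfN : ∀ l, DependsOn (f l) (N l)) (s : Finset ι) (x : ι → J) :
    lmarginal (fun _ => π) s (fun x => ∏ l, f l x ^ (1 / (p : ℝ))) x ≤
      ∏ l, lmarginal (fun _ => π) s (f l) x ^ (1 / (p : ℝ)) := by
  induction s using Finset.induction generalizing x with
  | empty => simp
  | insert i s hi ih =>
    have hm : Measurable fun x => ∏ l, f l x ^ (1 / (p : ℝ)) :=
      Finset.measurable_fun_prod _ fun l _ => (hf l).pow_const _
    have hG : ∀ l, Measurable fun t => lmarginal (fun _ => π) s (f l) (Function.update x i t) :=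
      fun l => ((hf l).lmarginal _).comp (measurable_update x)
    have hconst : ∀ l, i ∉ N l → ∀ t,
        lmarginal (fun _ => π) s (f l) (Function.update x i t) =
          lmarginal (fun _ => π) s (f l) x := fun l hl t => by
      rw [lmarginal_update_of_notMem (hf l) hi]
      congr 1
      ext z
      refine hfN l fun j hj => Function.update_of_ne ?_ _ _
      rintro rfl
      exact hl hj
    rw [lmarginal_insert _ hm hi]
    simp_rw [lmarginal_insert _ (hf _) hi]
    have hp0 : (0 : ℝ) < p := by positivity
    set K := Finset.univ.filter fun l => i ∈ N l
    set C := ∏ l with i ∉ N l, lmarginal (fun _ => π) s (f l) x ^ (1 / (p : ℝ))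
    calc _ ≤ ∫⁻ t, ∏ l, lmarginal (fun _ => π) s (f l) (Function.update x i t) ^ (1 / (p : ℝ)) ∂π :=
          lintegral_mono fun t => ih _
      _ = ∫⁻ t, C * ((fun _ => 1 : J → ℝ≥0∞) t ^ (1 - K.card / (p : ℝ)) * ∏ l ∈ K,
            lmarginal (fun _ => π) s (f l) (Function.update x i t) ^ (1 / (p : ℝ))) ∂π := by
          refine lintegral_congr fun t => ?_
          rw [← Finset.prod_filter_mul_prod_filter_not _ fun l => i ∈ N l, mul_comm,
            ENNReal.one_rpow, one_mul]
          congr 1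
          refine Finset.prod_congr rfl fun l hl => ?_
          rw [hconst l (Finset.mem_filter.1 hl).2]
      _ ≤ C * ((∫⁻ _, 1 ∂π) ^ (1 - K.card / (p : ℝ)) * ∏ l ∈ K,
            (∫⁻ t, lmarginal (fun _ => π) s (f l) (Function.update x i t) ∂π) ^ (1 / (p : ℝ))) := by
          rw [lintegral_const_mul]
          · gcongr
            refine ENNReal.lintegral_mul_prod_norm_pow_le K aemeasurable_const
              (fun l _ => (hG l).aemeasurable) _ ?_ ?_ fun _ _ => by positivity
            · simp; ring
            · rw [sub_nonneg, div_le_one hp0]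
              exact_mod_cast hN i
          · refine Measurable.mul (by fun_prop)
              (Finset.measurable_fun_prod _ fun l _ => (hG l).pow_const _)
      _ = _ := by
          rw [lintegral_const, measure_univ, mul_one, ENNReal.one_rpow, one_mul,
            ← Finset.prod_filter_mul_prod_filter_not Finset.univ fun l => i ∈ N l, mul_comm]
          congr 1
          refine Finset.prod_congr rfl fun l hl => ?_
          simp_rw [hconst l (Finset.mem_filter.1 hl).2]
          simp

/-- The Finner inequality. -/
theorem lintegral_prod_le_prod_eLpNorm [Fintype ι] [DecidableEq ι] [Fintype κ] (π : Measure J)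
    [IsProbabilityMeasure π] {N : κ → Finset ι} {p : ℕ} (hp : 1 ≤ p)
    (hN : ∀ i, (Finset.univ.filter fun l => i ∈ N l).card ≤ p) {f : κ → (ι → J) → ℝ≥0∞}
    (hf : ∀ l, Measurable (f l)) (hfN : ∀ l, DependsOn (f l) (N l)) :
    ∫⁻ x, ∏ l, f l x ∂(Measure.pi fun _ : ι => π) ≤
      ∏ l, eLpNorm (f l) p (Measure.pi fun _ : ι => π) := by
  obtain ⟨x₀⟩ : Nonempty J := nonempty_of_isProbabilityMeasure π
  have h := lmarginal_prod_rpow_le π hp hN (f := fun l x => f l x ^ p)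
    (fun l => (hf l).pow_const p) (fun l x y hxy => by simp only [hfN l hxy]) Finset.univ
    fun _ => x₀
  have hroot : ∀ a : ℝ≥0∞, (a ^ p) ^ (1 / (p : ℝ)) = a := fun a => by
    rw [one_div, ENNReal.pow_rpow_inv_natCast (Nat.one_le_iff_ne_zero.1 hp)]
  simp only [lmarginal_univ, hroot] at h
  simpa only [eLpNorm_natCast_eq _ _ hp] using h

end Products

section Star

variable (π : Measure J) (P : Kernel J J) {ι : Type*} [Fintype ι] [DecidableEq ι]

/-- `f` is the density, in the variables `N`, of the joint law of `N`-many independent steps from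
a common starting point which is restricted to `B`. -/
structure IsStar (N : Finset ι) (B : Set J) (f : (ι → J) → ℝ≥0∞) : Prop where
  measurable : Measurable f
  dependsOn : DependsOn f N
  setLIntegral_box : ∀ C : ι → Set J, (∀ i, MeasurableSet (C i)) →
    ∫⁻ x in Set.univ.pi C, f x ∂(Measure.pi fun _ => π) =
      (∏ i ∈ Nᶜ, π (C i)) * ∫⁻ y in B, ∏ i ∈ N, P y (C i) ∂π

theorem setLIntegral_box_restrict [IsProbabilityMeasure π] (N : Finset ι) {h : (N → J) → ℝ≥0∞}
    (hh : Measurable h) {C : ι → Set J} (hC : ∀ i, MeasurableSet (C i)) :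
    ∫⁻ x in Set.univ.pi C, h (fun i => x i) ∂(Measure.pi fun _ => π) =
      (∏ i ∈ Nᶜ, π (C i)) * ∫⁻ z in Set.univ.pi fun i : N => C i, h z ∂(Measure.pi fun _ => π) := by
  set μN : Measure (N → J) := Measure.pi fun _ => π
  set μN' : Measure ({i // i ∉ N} → J) := Measure.pi fun _ => π
  set S : Set (N → J) := Set.univ.pi fun i => C i
  set S' : Set ({i // i ∉ N} → J) := Set.univ.pi fun i => C i
  have hmp := measurePreserving_piEquivPiSubtypeProd (fun _ : ι => π) (· ∈ N)
  have hpre : Set.univ.pi C =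
      MeasurableEquiv.piEquivPiSubtypeProd (fun _ : ι => J) (· ∈ N) ⁻¹' (S ×ˢ S') := by
    ext x
    simp only [Set.mem_univ_pi, Set.mem_preimage, Set.mem_prod, S, S']
    constructor
    · exact fun hx => ⟨fun i => hx i, fun i => hx i⟩
    · rintro ⟨h1, h2⟩ i
      by_cases hi : i ∈ N
      exacts [h1 ⟨i, hi⟩, h2 ⟨i, hi⟩]
  have hS : MeasurableSet S := MeasurableSet.univ_pi fun i => hC i
  have hS' : MeasurableSet S' := MeasurableSet.univ_pi fun i => hC i
  calc ∫⁻ x in Set.univ.pi C, h (fun i => x i) ∂(Measure.pi fun _ => π)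
      = ∫⁻ z in S ×ˢ S', h z.1 ∂(μN.prod μN') := by
        rw [hpre]
        convert hmp.setLIntegral_comp_preimage (hS.prod hS') (hh.comp measurable_fst) using 5
          <;> rfl
    _ = ∫⁻ z in S, ∫⁻ _ in S', h z ∂μN' ∂μN := setLIntegral_prod _ (by fun_prop)
    _ = (∫⁻ z in S, h z ∂μN) * μN' S' := by
        simp_rw [setLIntegral_const]
        rw [lintegral_mul_const _ hh]
    _ = _ := by
        rw [mul_comm, Measure.pi_pi]
        congr 1
        exact (Finset.prod_subtype Nᶜ (by simp) fun i => π (C i)).symm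

variable {π P}

theorem IsStarDisint.isStar [IsProbabilityMeasure π] [IsMarkovKernel P] {N : Finset ι}
    {ψ : Kernel (N → J) J} (hψ : IsStarDisint π P ψ) {B : Set J} (hB : MeasurableSet B) :
    IsStar π P N B fun x => ψ (fun i => x i) B where
  measurable := (ψ.measurable_coe hB).comp (by fun_prop)
  dependsOn x y hxy := by
    simp only [show (fun i : N => x i) = fun i : N => y i from funext fun i => hxy i i.2]
  setLIntegral_box C hC := by
    rw [setLIntegral_box_restrict π N (ψ.measurable_coe hB) hC,
      hψ.2 _ _ (MeasurableSet.univ_pi fun i => hC i) hB]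
    simp_rw [Measure.pi_pi]
    congr 1
    refine lintegral_congr fun y => ?_
    exact Finset.prod_coe_sort N fun i => P y (C i)

theorem KLoose.isStar [IsProbabilityMeasure π] [IsMarkovKernel P] {k : ℕ} (h : KLoose π P k) :
    IsStar π P Finset.univ Set.univ (stepDensityIdx π P (Fin k)) where
  measurable := Measure.measurable_rnDeriv _ _
  dependsOn x y hxy := by rw [show x = y from funext fun i => hxy i (by simp)]
  setLIntegral_box C hC := by
    have hmeas : Measurable fun x => Measure.pi fun _ : Fin k => P x := by
      refine .measure_of_isPiSystem_of_isProbabilityMeasure generateFrom_pi.symm isPiSystem_pi ?_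
      rintro _ ⟨C, hC, rfl⟩
      simp_rw [Measure.pi_pi]
      exact Finset.measurable_fun_prod _ fun i _ => P.measurable_coe (hC i trivial)
    have : IsProbabilityMeasure (stepMeasureIdx π P (Fin k)) := by
      refine ⟨?_⟩
      rw [stepMeasureIdx, Measure.bind_apply .univ hmeas.aemeasurable]
      simp
    rw [stepDensityIdx, Measure.setLIntegral_rnDeriv h, stepMeasureIdx,
      Measure.bind_apply (MeasurableSet.univ_pi hC) hmeas.aemeasurable]
    simp

/-- The density of the kernel `P`, averaged over the cells of level `n` in the target point. -/
noncomputable def stepKernel (π : Measure J) (P : Kernel J J)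
    [MeasurableSpace.CountablyGenerated J] (n : ℕ) (x y : J) : ℝ≥0∞ :=
  (π (bitCell n x))⁻¹ * P y (bitCell n x)

variable [MeasurableSpace.CountablyGenerated J]

theorem measurable_stepKernel (n : ℕ) : Measurable (Function.uncurry (stepKernel π P n)) := by
  have h : Measurable fun z : J × (Fin n → Prop) =>
      (π (bits n ⁻¹' {z.2}))⁻¹ * P z.1 (bits n ⁻¹' {z.2}) :=
    measurable_from_prod_countable_left fun d =>
      Measurable.const_mul (P.measurable_coe (measurable_bits n (measurableSet_singleton d)))
        (π (bits n ⁻¹' {d}))⁻¹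
  have hg : Measurable fun z : J × J => (z.2, bits n z.1) :=
    measurable_snd.prodMk ((measurable_bits n).comp measurable_fst)
  have heq : Function.uncurry (stepKernel π P n) = fun z : J × J =>
      (π (bits n ⁻¹' {bits n z.1}))⁻¹ * P z.2 (bits n ⁻¹' {bits n z.1}) := rfl
  rw [heq]
  have := h.comp hg
  simp only [Function.comp_def] at this
  exact this

theorem Measurable.stepKernel {X : Type*} [MeasurableSpace X] {f g : X → J} (hf : Measurable f)
    (hg : Measurable g) (n : ℕ) : Measurable fun z => stepKernel π P n (f z) (g z) := by
  have := (measurable_stepKernel (π := π) (P := P) n).comp (hf.prodMk hg)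
  simp only [Function.comp_def, Function.uncurry_apply_pair] at this
  exact this

theorem IsStar.cellAvg_ae [IsProbabilityMeasure π] {N : Finset ι} {B : Set J}
    {f : (ι → J) → ℝ≥0∞} (hf : IsStar π P N B f) (n : ι → ℕ) :
    cellAvg (Measure.pi fun _ => π) (boxBits n) f =ᵐ[Measure.pi fun _ => π]
      fun x => ∫⁻ y in B, ∏ i ∈ N, stepKernel π P (n i) (x i) y ∂π := by
  filter_upwards [ae_bitCell_ne_zero π n] with x hx
  rw [cellAvg_boxBits, hf.setLIntegral_box _ fun i => measurableSet_bitCell _ _]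
  simp_rw [stepKernel, Finset.prod_mul_distrib]
  rw [lintegral_const_mul _ (Finset.measurable_fun_prod _ fun i _ =>
    P.measurable_coe (measurableSet_bitCell _ _)), ← mul_assoc]
  congr 1
  rw [← Finset.prod_mul_prod_compl N, mul_assoc, ← Finset.prod_mul_distrib,
    Finset.prod_eq_one (s := Nᶜ), mul_one]
  exact fun i _ => ENNReal.inv_mul_cancel (hx i) (measure_ne_top _ _)

end Star

section Averages

variable {ι κ : Type*} [Fintype ι] [Fintype κ]
  {π : Measure J} [IsProbabilityMeasure π] {P : Kernel J J}

theorem lintegral_setLIntegral_prod_pow [DecidableEq κ] {V : J → J → ℝ≥0∞}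
    (hV : Measurable (Function.uncurry V)) {A : Set J} (hA : MeasurableSet A) (L : Finset κ)
    (k : ℕ) :
    ∫⁻ y : κ → J, (∫⁻ x in A, ∏ l ∈ L, V x (y l) ∂π) ^ k ∂(Measure.pi fun _ => π) =
      ∫⁻ x in Set.univ.pi fun _ : Fin k => A, (∫⁻ y, ∏ i, V (x i) y ∂π) ^ L.card
        ∂(Measure.pi fun _ => π) := by
  have h := lintegral_prod_lintegral_comm (ι := Fin k) (κ := κ) π
    (N := fun l => if l ∈ L then Finset.univ else ∅) (M := fun _ => L)
    (fun i l => by by_cases hl : l ∈ L <;> simp [hl]) (V := fun _ => V) (fun _ => hV)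
    (A := fun _ => A) (fun _ => hA) (B := fun _ => Set.univ) (fun _ => .univ)
  simp only [Finset.prod_const, Finset.card_univ, Fintype.card_fin, Set.pi_univ,
    Measure.restrict_univ] at h
  rw [← h]
  refine lintegral_congr fun x => ?_
  rw [← Finset.prod_const, ← Finset.prod_subset (Finset.subset_univ L)]
  · exact Finset.prod_congr rfl fun l hl => by simp [hl]
  · intro l _ hl
    simp [hl]

theorem lintegral_pow_le_one_add {X : Type*} [MeasurableSpace X] (μ : Measure X)
    [IsProbabilityMeasure μ] (f : X → ℝ≥0∞) {a b : ℕ} (hab : a ≤ b) :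
    ∫⁻ x, f x ^ a ∂μ ≤ 1 + ∫⁻ x, f x ^ b ∂μ := by
  calc ∫⁻ x, f x ^ a ∂μ ≤ ∫⁻ x, (1 + f x ^ b) ∂μ := by
        refine lintegral_mono fun x => ?_
        rcases le_total (f x) 1 with h | h
        · exact (pow_le_one₀ zero_le h).trans le_self_add
        · exact (pow_le_pow_right₀ h hab).trans le_add_self
    _ = _ := by rw [lintegral_add_left measurable_const]; simp

theorem tendsto_of_le_add {I : Type*} {l : Filter I} {a ε : I → ℝ≥0∞} {b : ℝ≥0∞}
    (h1 : ∀ n, a n ≤ b + ε n) (h2 : ∀ n, b ≤ a n + ε n) (hε : Tendsto ε l (nhds 0)) :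
    Tendsto a l (nhds b) := by
  have hlow : Tendsto (fun n => b - ε n) l (nhds b) := by
    simpa using ENNReal.Tendsto.sub (tendsto_const_nhds (x := b)) hε (.inr ENNReal.zero_ne_top)
  have hup : Tendsto (fun n => b + ε n) l (nhds b) := by
    simpa using (tendsto_const_nhds (x := b)).add hε
  exact tendsto_of_tendsto_of_tendsto_of_le_of_le hlow hup
    (fun n => tsub_le_iff_right.2 (h2 n)) h1

theorem IsStar.lintegral_le_one [IsMarkovKernel P] [DecidableEq ι] {N : Finset ι} {B : Set J}
    {f : (ι → J) → ℝ≥0∞} (hf : IsStar π P N B f) :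
    ∫⁻ x, f x ∂(Measure.pi fun _ => π) ≤ 1 := by
  have h := hf.setLIntegral_box (fun _ => Set.univ) fun _ => .univ
  simp only [Set.pi_univ, Measure.restrict_univ] at h
  simpa [h] using prob_le_one (μ := π) (s := B)

variable [MeasurableSpace.CountablyGenerated J]

/-- The star density with the leaves `x` replaced by their cells. -/
noncomputable def leafAvg (π : Measure J) (P : Kernel J J) (N : Finset ι) (B : Set J) (n : ι → ℕ)
    (x : ι → J) : ℝ≥0∞ :=
  ∫⁻ y in B, ∏ i ∈ N, stepKernel π P (n i) (x i) y ∂π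

/-- The star density with leaves `y`, whose centre is replaced by its cell. -/
noncomputable def centreAvg (π : Measure J) (P : Kernel J J) (M : Finset κ) (A : Set J) (m : ℕ)
    (y : κ → J) : ℝ≥0∞ :=
  ∫⁻ x in A, ∏ l ∈ M, stepKernel π P m x (y l) ∂π

theorem measurable_leafAvg {ι : Type*} (N : Finset ι) (B : Set J) (n : ι → ℕ) :
    Measurable (leafAvg π P N B n) := by
  refine Measurable.lintegral_prod_right' (f := fun z : (ι → J) × J =>
    ∏ i ∈ N, stepKernel π P (n i) (z.1 i) z.2) ?_
  refine Finset.measurable_fun_prod _ fun i _ => ?_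
  exact Measurable.stepKernel (by fun_prop) (by fun_prop) _

theorem dependsOn_leafAvg {ι : Type*} {π : Measure J} (N : Finset ι) (B : Set J) (n : ι → ℕ) :
    DependsOn (leafAvg π P N B n) N := fun x y hxy => by
  refine lintegral_congr fun z => Finset.prod_congr rfl fun i hi => ?_
  rw [hxy i hi]

theorem measurable_centreAvg {κ : Type*} (M : Finset κ) (A : Set J) (m : ℕ) :
    Measurable (centreAvg π P M A m) := by
  refine Measurable.lintegral_prod_right' (f := fun z : (κ → J) × J =>
    ∏ l ∈ M, stepKernel π P m z.2 (z.1 l)) ?_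
  refine Finset.measurable_fun_prod _ fun l _ => ?_
  exact Measurable.stepKernel (by fun_prop) (by fun_prop) _

theorem dependsOn_centreAvg {κ : Type*} {π : Measure J} (M : Finset κ) (A : Set J) (m : ℕ) :
    DependsOn (centreAvg π P M A m) M := fun x y hxy => by
  refine lintegral_congr fun z => Finset.prod_congr rfl fun l hl => ?_
  rw [hxy l hl]

theorem lintegral_centreAvg_pow_le [DecidableEq κ] {k p : ℕ} {s : (Fin k → J) → ℝ≥0∞}
    (hs : IsStar π P Finset.univ Set.univ s) {A : Set J} (hA : MeasurableSet A) {M : Finset κ}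
    (hM : M.card ≤ p) (m : ℕ) :
    ∫⁻ y, centreAvg π P M A m y ^ k ∂(Measure.pi fun _ => π) ≤
      1 + ∫⁻ x, s x ^ p ∂(Measure.pi fun _ => π) := by
  simp only [centreAvg]
  rw [lintegral_setLIntegral_prod_pow (measurable_stepKernel m) hA]
  calc _ ≤ ∫⁻ x : Fin k → J, (∫⁻ y, ∏ i, stepKernel π P m (x i) y ∂π) ^ M.card
        ∂(Measure.pi fun _ => π) := setLIntegral_le_lintegral _ _
    _ = ∫⁻ x, cellAvg (Measure.pi fun _ => π) (boxBits fun _ => m) s x ^ M.card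
          ∂(Measure.pi fun _ => π) := by
        refine lintegral_congr_ae ?_
        filter_upwards [hs.cellAvg_ae fun _ => m] with x hx
        rw [hx, Measure.restrict_univ]
    _ ≤ ∫⁻ x, s x ^ M.card ∂(Measure.pi fun _ => π) :=
        lintegral_cellAvg_pow_le _ (measurable_boxBits _) hs.measurable _
    _ ≤ _ := lintegral_pow_le_one_add _ _ hM

/-- Star densities with at most `k` leaves lie in `L^p` over a `(k,p)`-loose space. -/
theorem IsStar.lintegral_pow_le [IsMarkovKernel P] [DecidableEq ι] {k p : ℕ}
    {s : (Fin k → J) → ℝ≥0∞} (hs : IsStar π P Finset.univ Set.univ s) {N : Finset ι}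
    (hN : N.card ≤ k) {B : Set J} (hB : MeasurableSet B) {f : (ι → J) → ℝ≥0∞}
    (hf : IsStar π P N B f) :
    ∫⁻ x, f x ^ p ∂(Measure.pi fun _ => π) ≤
      1 + (1 + ∫⁻ x, s x ^ p ∂(Measure.pi fun _ => π)) := by
  refine isRefining_boxBits_const.lintegral_pow_le_of_cellAvg _ hf.measurable
    (hf.lintegral_le_one.trans_lt ENNReal.one_lt_top) p fun j => ?_
  have hV : Measurable (Function.uncurry fun y x => stepKernel π P j x y) :=
    Measurable.stepKernel measurable_snd measurable_fst j
  calc _ = ∫⁻ x : ι → J, (∫⁻ y in B, ∏ i ∈ N, stepKernel π P j (x i) y ∂π) ^ p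
        ∂(Measure.pi fun _ => π) := by
        refine lintegral_congr_ae ?_
        filter_upwards [hf.cellAvg_ae fun _ => j] with x hx
        rw [hx]
    _ = ∫⁻ y in Set.univ.pi fun _ : Fin p => B,
          (∫⁻ x, ∏ l, stepKernel π P j x (y l) ∂π) ^ N.card ∂(Measure.pi fun _ => π) :=
        lintegral_setLIntegral_prod_pow hV hB N p
    _ ≤ ∫⁻ y : Fin p → J, (∫⁻ x, ∏ l, stepKernel π P j x (y l) ∂π) ^ N.card
          ∂(Measure.pi fun _ => π) := setLIntegral_le_lintegral _ _
    _ ≤ 1 + ∫⁻ y : Fin p → J, (∫⁻ x, ∏ l, stepKernel π P j x (y l) ∂π) ^ k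
          ∂(Measure.pi fun _ => π) := lintegral_pow_le_one_add _ _ hN
    _ ≤ _ := by
        have h := lintegral_centreAvg_pow_le hs .univ (M := (Finset.univ : Finset (Fin p)))
          (p := p) (by simp) j
        simp only [centreAvg, Measure.restrict_univ] at h
        gcongr

theorem cellAvg_bits_le_one {π : Measure J} [IsMarkovKernel P] (m : ℕ) (D : Set J) (x : J) :
    cellAvg π (bits m) (fun z => P z D) x ≤ 1 := by
  calc cellAvg π (bits m) (fun z => P z D) x
      ≤ (π (bitCell m x))⁻¹ * ∫⁻ _ in bitCell m x, 1 ∂π := by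
        unfold cellAvg bitCell
        gcongr
        exact prob_le_one
    _ ≤ 1 := by simp

theorem setLIntegral_stepKernel {π : Measure J} (hrev : P.IsReversible π) (m : ℕ) {D : Set J}
    (hD : MeasurableSet D) (x : J) :
    ∫⁻ y in D, stepKernel π P m x y ∂π = cellAvg π (bits m) (fun z => P z D) x := by
  simp only [stepKernel]
  rw [lintegral_const_mul _ (P.measurable_coe (measurableSet_bitCell m x)),
    hrev hD (measurableSet_bitCell m x)]
  rfl

theorem setLIntegral_centreAvg [DecidableEq κ] (hrev : P.IsReversible π) (M : Finset κ)
    (A : Set J) (m : ℕ) {D : κ → Set J} (hD : ∀ l, MeasurableSet (D l)) :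
    ∫⁻ y in Set.univ.pi D, centreAvg π P M A m y ∂(Measure.pi fun _ => π) =
      (∏ l ∈ Mᶜ, π (D l)) *
        ∫⁻ x in A, ∏ l ∈ M, cellAvg π (bits m) (fun z => P z (D l)) x ∂π := by
  have hW : ∀ x, Measurable (stepKernel π P m x) := fun x =>
    Measurable.stepKernel measurable_const measurable_id m
  have hcell : ∀ l, Measurable (cellAvg π (bits m) fun z => P z (D l)) := fun l =>
    measurable_cellAvg _ (measurable_bits m) _
  simp only [centreAvg]
  rw [lintegral_lintegral_swap, ← lintegral_const_mul]
  · refine lintegral_congr fun x => ?_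
    have h := setLIntegral_pi_prod π hD (f := fun l => if l ∈ M then stepKernel π P m x else 1)
      fun l => by split_ifs; exacts [hW x, measurable_const]
    have hprod : ∀ y : κ → J, ∏ l, (if l ∈ M then stepKernel π P m x else 1) (y l) =
        ∏ l ∈ M, stepKernel π P m x (y l) := fun y => by
      rw [← Finset.prod_subset (Finset.subset_univ M) fun l _ hl => by simp [hl]]
      exact Finset.prod_congr rfl fun l hl => by simp [hl]
    simp_rw [hprod] at h
    rw [h, ← Finset.prod_mul_prod_compl M, mul_comm]
    congr 1
    · refine Finset.prod_congr rfl fun l hl => ?_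
      simp [Finset.mem_compl.1 hl]
    · refine Finset.prod_congr rfl fun l hl => ?_
      simp only [hl, if_true]
      exact setLIntegral_stepKernel hrev m (hD l) x
  · exact Finset.measurable_fun_prod _ fun l _ => hcell l
  · refine Measurable.aemeasurable (Finset.measurable_fun_prod _ fun l _ => ?_)
    exact Measurable.stepKernel (by fun_prop) (by fun_prop) _

theorem tendsto_setLIntegral_prod_cellAvg {κ : Type*} [IsMarkovKernel P] (M : Finset κ) (A : Set J)
    {D : κ → Set J} (hD : ∀ l, MeasurableSet (D l)) :
    Tendsto (fun m => ∫⁻ x in A, ∏ l ∈ M, cellAvg π (bits m) (fun z => P z (D l)) x ∂π) atTop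
      (nhds (∫⁻ x in A, ∏ l ∈ M, P x (D l) ∂π)) := by
  classical
  set a : ℕ → κ → J → ℝ≥0∞ := fun m l => cellAvg π (bits m) fun z => P z (D l)
  have hb : ∀ l, Measurable fun x => P x (D l) := fun l => P.measurable_coe (hD l)
  have ha : ∀ m l, Measurable (a m l) := fun m l => measurable_cellAvg _ (measurable_bits m) _
  set δ : ℕ → κ → J → ℝ≥0∞ := fun m l x => absDiff (a m l x) (P x (D l))
  have hδ : ∀ m l, Measurable (δ m l) := fun m l => (ha m l).absDiff (hb l)
  have hlim : ∀ l, Tendsto (fun m => ∫⁻ x, δ m l x ∂π) atTop (nhds 0) := fun l => by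
    have h := isRefining_bits.tendsto_eLpNorm_absDiff π le_rfl (hb l)
      ((eLpNorm_natCast_lt_top_iff π _ le_rfl).2 ?_)
    · simpa [eLpNorm_one_eq_lintegral_enorm] using h
    · refine lt_of_le_of_lt (lintegral_mono (g := 1) fun x => ?_) (by simp)
      simpa using prob_le_one
  have hbound : ∀ (u v : κ → J → ℝ≥0∞) (m : ℕ), (∀ l, Measurable (v l)) →
      (∀ l x, u l x ≤ 1) → (∀ l x, v l x ≤ 1) → (∀ l x, u l x ≤ v l x + δ m l x) →
      ∫⁻ x in A, ∏ l ∈ M, u l x ∂π ≤ ∫⁻ x in A, ∏ l ∈ M, v l x ∂π +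
        ∑ l ∈ M, (∫⁻ x, δ m l x ∂π) * 2 ^ (M.erase l).card := by
    intro u v m hv hu1 hv1 huv
    calc ∫⁻ x in A, ∏ l ∈ M, u l x ∂π
        ≤ ∫⁻ x in A, (∏ l ∈ M, v l x + ∑ l ∈ M, δ m l x * 2 ^ (M.erase l).card) ∂π := by
          refine lintegral_mono fun x => (prod_le_prod_add_sum M fun l _ => huv l x).trans ?_
          gcongr with l hl
          refine Finset.prod_le_pow_card _ _ _ fun j _ => ?_
          exact (add_le_add (hu1 j x) (hv1 j x)).trans one_add_one_eq_two.le
      _ = ∫⁻ x in A, ∏ l ∈ M, v l x ∂π +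
            ∑ l ∈ M, (∫⁻ x in A, δ m l x ∂π) * 2 ^ (M.erase l).card := by
          rw [lintegral_add_left (Finset.measurable_fun_prod _ fun l _ => hv l),
            lintegral_finsetSum _ fun l _ => (hδ m l).mul_const _]
          simp_rw [lintegral_mul_const _ (hδ m _)]
      _ ≤ _ := by
          gcongr
          exact Measure.restrict_le_self
  have hsum : Tendsto (fun m => ∑ l ∈ M, (∫⁻ x, δ m l x ∂π) * 2 ^ (M.erase l).card) atTop
      (nhds 0) := by
    have : Tendsto (fun m => ∑ l ∈ M, (∫⁻ x, δ m l x ∂π) * 2 ^ (M.erase l).card) atTop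
        (nhds (∑ l ∈ M, 0 * 2 ^ (M.erase l).card)) := tendsto_finsetSum _ fun l _ =>
      ENNReal.Tendsto.mul_const (hlim l) (.inr (by simp))
    simpa using this
  refine tendsto_of_le_add (fun m => ?_) (fun m => ?_) hsum
  · exact hbound (a m) (fun l x => P x (D l)) m hb (fun l => cellAvg_bits_le_one m _)
      (fun l x => prob_le_one) fun l x => le_add_absDiff _ _
  · refine hbound (fun l x => P x (D l)) (a m) m (ha m) (fun l x => prob_le_one)
      (fun l => cellAvg_bits_le_one m _) fun l x => ?_
    simp only [δ]
    rw [absDiff_comm]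
    exact le_add_absDiff _ _

/-- The centre averages converge weakly to the star density. -/
theorem IsStar.tendsto_setLIntegral_centreAvg [IsMarkovKernel P] [DecidableEq κ]
    (hrev : P.IsReversible π) {M : Finset κ} {A : Set J} {f : (κ → J) → ℝ≥0∞}
    (hf : IsStar π P M A f) {D : κ → Set J} (hD : ∀ l, MeasurableSet (D l)) :
    Tendsto (fun m => ∫⁻ y in Set.univ.pi D, centreAvg π P M A m y ∂(Measure.pi fun _ => π)) atTop
      (nhds (∫⁻ y in Set.univ.pi D, f y ∂(Measure.pi fun _ => π))) := by
  rw [hf.setLIntegral_box D hD]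
  simp_rw [setLIntegral_centreAvg hrev M A _ hD]
  refine ENNReal.Tendsto.const_mul (tendsto_setLIntegral_prod_cellAvg M A hD) (.inr ?_)
  exact ENNReal.prod_ne_top fun l _ => measure_ne_top _ _

/-- Weak limits of centre averages inherit their `L^k` bounds. -/
theorem IsStar.lintegral_pow_le_of_centreAvg [IsMarkovKernel P] [DecidableEq κ]
    (hrev : P.IsReversible π) {M : Finset κ} {A : Set J} {f : (κ → J) → ℝ≥0∞}
    (hf : IsStar π P M A f) {k : ℕ} {K : ℝ≥0∞}
    (hK : ∀ m, ∫⁻ y, centreAvg π P M A m y ^ k ∂(Measure.pi fun _ => π) ≤ K) :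
    ∫⁻ y, f y ^ k ∂(Measure.pi fun _ => π) ≤ K := by
  refine isRefining_boxBits_const.lintegral_pow_le_of_cellAvg _ hf.measurable
    (hf.lintegral_le_one.trans_lt ENNReal.one_lt_top) k fun j => ?_
  have hc := measurable_boxBits (J := J) fun _ : κ => j
  set ν : Measure (κ → J) := Measure.pi fun _ => π
  have hlim : ∀ᵐ y ∂ν, Tendsto
      (fun m => cellAvg ν (boxBits fun _ => j) (centreAvg π P M A m) y ^ k) atTop
      (nhds (cellAvg ν (boxBits fun _ => j) f y ^ k)) := by
    filter_upwards [ae_class_measure_ne_zero ν (c := boxBits fun _ => j)] with y hy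
    refine ((ENNReal.continuous_pow k).tendsto _).comp ?_
    refine ENNReal.Tendsto.const_mul ?_ (.inr (ENNReal.inv_ne_top.2 hy))
    rw [boxBits_preimage_singleton]
    exact hf.tendsto_setLIntegral_centreAvg hrev fun l => measurableSet_bitCell _ _
  calc ∫⁻ y, cellAvg ν (boxBits fun _ => j) f y ^ k ∂ν
      = ∫⁻ y, liminf (fun m => cellAvg ν (boxBits fun _ => j) (centreAvg π P M A m) y ^ k)
          atTop ∂ν := by
        refine lintegral_congr_ae ?_
        filter_upwards [hlim] with y hy
        exact hy.liminf_eq.symm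
    _ ≤ liminf (fun m => ∫⁻ y, cellAvg ν (boxBits fun _ => j) (centreAvg π P M A m) y ^ k ∂ν)
          atTop := lintegral_liminf_le fun m => (measurable_cellAvg _ hc _).pow_const k
    _ ≤ liminf (fun _ : ℕ => K) atTop := by
        refine liminf_le_liminf (.of_forall fun m => ?_)
        exact (lintegral_cellAvg_pow_le ν hc (measurable_centreAvg M A m) k).trans (hK m)
    _ = K := by simp

end Averages

section Products

theorem tendsto_of_forall_approx {a : ℕ → ℝ≥0∞} {b C : ℝ≥0∞} (hC : C ≠ ⊤)
    (h : ∀ δ : ℝ≥0∞, δ ≠ 0 → δ ≤ 1 → ∃ (a' : ℕ → ℝ≥0∞) (b' : ℝ≥0∞),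
      Tendsto a' atTop (nhds b') ∧ (∀ m, a m ≤ a' m + C * δ) ∧ (∀ m, a' m ≤ a m + C * δ) ∧
        b ≤ b' + C * δ ∧ b' ≤ b + C * δ) :
    Tendsto a atTop (nhds b) := by
  have hδ : Tendsto (fun n : ℕ => C * (n : ℝ≥0∞)⁻¹ + C * (n : ℝ≥0∞)⁻¹) atTop (nhds 0) := by
    have := ENNReal.Tendsto.const_mul (a := C) ENNReal.tendsto_inv_nat_nhds_zero (.inr hC)
    simpa using this.add this
  have hle : ∀ x y : ℝ≥0∞, (∀ δ : ℝ≥0∞, δ ≠ 0 → δ ≤ 1 → x ≤ y + (C * δ + C * δ)) → x ≤ y := by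
    intro x y hxy
    have hlim : Tendsto (fun n : ℕ => y + (C * (n : ℝ≥0∞)⁻¹ + C * (n : ℝ≥0∞)⁻¹)) atTop
        (nhds y) := by
      simpa using (tendsto_const_nhds (x := y)).add hδ
    refine ge_of_tendsto hlim ?_
    filter_upwards [eventually_ge_atTop 1] with n hn
    exact hxy _ (ENNReal.inv_ne_zero.2 (ENNReal.natCast_ne_top n))
      (ENNReal.inv_le_one.2 (by exact_mod_cast hn))
  refine tendsto_of_le_liminf_of_limsup_le (hle _ _ fun δ h0 h1 => ?_) (hle _ _ fun δ h0 h1 => ?_)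
  · obtain ⟨a', b', ht, -, ha', hb, -⟩ := h δ h0 h1
    have : b' ≤ liminf a atTop + C * δ := by
      rw [← tsub_le_iff_right]
      have hlim : Tendsto (fun m => a' m - C * δ) atTop (nhds (b' - C * δ)) :=
        ENNReal.Tendsto.sub ht tendsto_const_nhds
          (.inr (ENNReal.mul_ne_top hC (h1.trans_lt ENNReal.one_lt_top).ne))
      rw [← hlim.liminf_eq]
      exact liminf_le_liminf (.of_forall fun m => tsub_le_iff_right.2 (ha' m))
    calc b ≤ b' + C * δ := hb
      _ ≤ _ := by rw [← add_assoc]; gcongr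
  · obtain ⟨a', b', ht, ha, -, -, hb'⟩ := h δ h0 h1
    calc limsup a atTop ≤ limsup (fun m => a' m + C * δ) atTop :=
          limsup_le_limsup (.of_forall ha)
      _ = b' + C * δ := (ht.add tendsto_const_nhds).limsup_eq
      _ ≤ _ := by rw [← add_assoc]; gcongr

variable {ι κ : Type*} [Fintype ι] [DecidableEq ι] [Fintype κ] [DecidableEq κ]
  (π : Measure J) [IsProbabilityMeasure π] {N : κ → Finset ι} {p : ℕ}

theorem setLIntegral_prod_le_add_mul (hp : 1 ≤ p)
    (hN : ∀ i, (Finset.univ.filter fun l => i ∈ N l).card ≤ p) {a b : κ → (ι → J) → ℝ≥0∞}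
    (ha : ∀ l, Measurable (a l)) (hb : ∀ l, Measurable (b l)) (haN : ∀ l, DependsOn (a l) (N l))
    (hbN : ∀ l, DependsOn (b l) (N l)) {K δ : ℝ≥0∞}
    (haK : ∀ l, eLpNorm (a l) p (Measure.pi fun _ => π) ≤ K)
    (hbK : ∀ l, eLpNorm (b l) p (Measure.pi fun _ => π) ≤ K)
    (hab : ∀ l, eLpNorm (fun x => absDiff (a l x) (b l x)) p (Measure.pi fun _ => π) ≤ δ)
    (S : Set (ι → J)) :
    ∫⁻ x in S, ∏ l, a l x ∂(Measure.pi fun _ => π) ≤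
      ∫⁻ x in S, ∏ l, b l x ∂(Measure.pi fun _ => π) +
        (∑ l : κ, (K + K) ^ (Finset.univ.erase l).card) * δ := by
  set μ : Measure (ι → J) := Measure.pi fun _ => π
  have hab' : ∀ l, Measurable fun x => absDiff (a l x) (b l x) := fun l => (ha l).absDiff (hb l)
  set r : κ → κ → (ι → J) → ℝ≥0∞ := fun l =>
    Function.update (fun j => a j + b j) l fun x => absDiff (a l x) (b l x)
  have hr : ∀ l j, Measurable (r l j) := fun l j => by
    by_cases hj : j = l
    · subst hj; simpa [r] using hab' j
    · simpa [r, hj] using (ha j).add (hb j)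
  have hrN : ∀ l j, DependsOn (r l j) (N j) := fun l j x y hxy => by
    by_cases hj : j = l
    · subst hj; simp [r, haN j hxy, hbN j hxy]
    · simp [r, hj, haN j hxy, hbN j hxy]
  have hrprod : ∀ l x, absDiff (a l x) (b l x) * ∏ j ∈ Finset.univ.erase l, (a j x + b j x) =
      ∏ j, r l j x := fun l x => by
    rw [← Finset.mul_prod_erase _ _ (Finset.mem_univ l)]
    congr 1
    · simp [r]
    · exact Finset.prod_congr rfl fun j hj => by simp [r, Finset.ne_of_mem_erase hj]
  have hp1 : (1 : ℝ≥0∞) ≤ p := by exact_mod_cast hp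
  calc ∫⁻ x in S, ∏ l, a l x ∂μ
      ≤ ∫⁻ x in S, (∏ l, b l x + ∑ l, ∏ j, r l j x) ∂μ := by
        refine lintegral_mono fun x => ?_
        simp_rw [← hrprod]
        exact prod_le_prod_add_sum _ fun l _ => le_add_absDiff _ _
    _ = ∫⁻ x in S, ∏ l, b l x ∂μ + ∑ l, ∫⁻ x in S, ∏ j, r l j x ∂μ := by
        rw [lintegral_add_left (Finset.measurable_fun_prod _ fun l _ => hb l),
          lintegral_finsetSum _ fun l _ => Finset.measurable_fun_prod _ fun j _ => hr l j]
    _ ≤ _ := by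
        rw [Finset.sum_mul]
        gcongr with l _
        calc ∫⁻ x in S, ∏ j, r l j x ∂μ ≤ ∫⁻ x, ∏ j, r l j x ∂μ := setLIntegral_le_lintegral _ _
          _ ≤ ∏ j, eLpNorm (r l j) p μ := lintegral_prod_le_prod_eLpNorm π hp hN (hr l) (hrN l)
          _ = (∏ j ∈ Finset.univ.erase l, eLpNorm (r l j) p μ) * eLpNorm (r l l) p μ :=
              (Finset.prod_erase_mul _ _ (Finset.mem_univ l)).symm
          _ ≤ _ := by
              gcongr
              · refine Finset.prod_le_pow_card _ _ _ fun j hj => ?_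
                have : r l j = a j + b j := by
                  funext x
                  simp [r, Finset.ne_of_mem_erase hj]
                rw [this]
                exact (eLpNorm_add_le (ha j).aestronglyMeasurable (hb j).aestronglyMeasurable
                  hp1).trans (add_le_add (haK j) (hbK j))
              · simpa [r] using hab l

variable [MeasurableSpace.CountablyGenerated J]

theorem exists_boxBits_approx (hp : 1 ≤ p) {s : Finset ι} {f : (ι → J) → ℝ≥0∞}
    (hf : Measurable f) (hfs : DependsOn f s)
    (hfp : eLpNorm f p (Measure.pi fun _ => π) < ⊤) {ε : ℝ≥0∞} (hε : ε ≠ 0) :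
    ∃ (j : ℕ) (G : (ι → Fin j → Prop) → NNReal),
      DependsOn (fun x : ι → J => (G (boxBits (fun _ => j) x) : ℝ≥0∞)) s ∧
      eLpNorm (fun x => absDiff (f x) (G (boxBits (fun _ => j) x))) p (Measure.pi fun _ => π)
        ≤ ε := by
  have : Nonempty J := nonempty_of_isProbabilityMeasure π
  let x₀ : J := Classical.arbitrary J
  let res : (ι → J) → (s → J) := fun x i => x i
  let ext : (s → J) → (ι → J) := fun z i => if h : i ∈ s then z ⟨i, h⟩ else x₀
  have hres : MeasurePreserving res (Measure.pi fun _ => π) (Measure.pi fun _ => π) := by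
    convert measurePreserving_fst.comp (measurePreserving_piEquivPiSubtypeProd (fun _ => π) (· ∈ s))
    rfl
  have hext : Measurable ext := measurable_pi_lambda _ fun i => by
    by_cases h : i ∈ s
    · simpa [ext, h] using measurable_pi_apply _
    · simp [ext, h]
  have hfe : ∀ x, f x = f (ext (res x)) := fun x => hfs fun i hi => by
    simp [ext, res, Finset.mem_coe.1 hi]
  have hfe' : f = (f ∘ ext) ∘ res := funext hfe
  have hnorm : eLpNorm (f ∘ ext) p (Measure.pi fun _ => π) < ⊤ := by
    rwa [← eLpNorm_comp_measurePreserving (hf.comp hext).aestronglyMeasurable hres, ← hfe']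
  obtain ⟨j, G, hG⟩ := isRefining_boxBits_const.exists_step_approx_ennreal
    (Measure.pi fun _ : s => π) hp (hf.comp hext) hnorm hε
  refine ⟨j, fun d => G fun i => d i, fun x y hxy => ?_, ?_⟩
  · have : ∀ i : s, x i = y i := fun i => hxy i i.2
    simp only [boxBits, this]
  · have hmeas : Measurable fun z => absDiff ((f ∘ ext) z) (G (boxBits (fun _ => j) z)) :=
      (hf.comp hext).absDiff
        ((Measurable.of_discrete (f := fun d => (G d : ℝ≥0∞))).comp (measurable_boxBits _))
    rw [← eLpNorm_comp_measurePreserving hmeas.aestronglyMeasurable hres] at hG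
    have heq : (fun x => absDiff (f x) (G fun i => boxBits (fun _ => j) x i)) =
        (fun z => absDiff ((f ∘ ext) z) (G (boxBits (fun _ => j) z))) ∘ res := by
      funext x
      simp only [Function.comp_apply, ← hfe]
      rfl
    rw [heq]
    exact hG

theorem boxBits_preimage_eq_pi {ι : Type*} (j : ℕ) (d : ι → Fin j → Prop) :
    boxBits (J := J) (fun _ => j) ⁻¹' {d} = Set.univ.pi fun i => bits j ⁻¹' {d i} := by
  ext x
  simp [boxBits, funext_iff, Set.mem_pi]

theorem setLIntegral_boxBits_mul (π : Measure J) (j : ℕ) (F : (ι → Fin j → Prop) → ℝ≥0∞)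
    (g : (ι → J) → ℝ≥0∞) (hg : Measurable g) {B : ι → Set J} (hB : ∀ i, MeasurableSet (B i)) :
    ∫⁻ x in Set.univ.pi B, F (boxBits (fun _ => j) x) * g x ∂(Measure.pi fun _ => π) =
      ∑ d, F d * ∫⁻ x in Set.univ.pi fun i => bits j ⁻¹' {d i} ∩ B i, g x
        ∂(Measure.pi fun _ => π) := by
  have hc := measurable_boxBits (J := J) fun _ : ι => j
  rw [lintegral_eq_sum_class _ hc]
  refine Finset.sum_congr rfl fun d _ => ?_
  have hd : MeasurableSet (boxBits (J := J) (fun _ : ι => j) ⁻¹' {d}) :=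
    hc (measurableSet_singleton d)
  rw [Measure.restrict_restrict hd, Set.pi_inter_distrib, ← boxBits_preimage_eq_pi,
    ← lintegral_const_mul _ hg]
  refine setLIntegral_congr_fun (hd.inter (.univ_pi hB)) fun x hx => ?_
  rw [show boxBits (fun _ => j) x = d from hx.1]

/-- A product of `L^p` functions each depending on few coordinates is continuous under weak
convergence of one bounded factor. -/
theorem tendsto_setLIntegral_prod_update (hp : 1 ≤ p)
    (hN : ∀ i, (Finset.univ.filter fun l => i ∈ N l).card ≤ p) {H : κ → (ι → J) → ℝ≥0∞}
    (hH : ∀ l, Measurable (H l)) (hHN : ∀ l, DependsOn (H l) (N l)) (l₀ : κ)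
    {g : ℕ → (ι → J) → ℝ≥0∞} {f : (ι → J) → ℝ≥0∞} (hg : ∀ m, Measurable (g m))
    (hf : Measurable f) (hgN : ∀ m, DependsOn (g m) (N l₀)) (hfN : DependsOn f (N l₀))
    {K : ℝ≥0∞} (hK : K ≠ ⊤) (hHK : ∀ l, eLpNorm (H l) p (Measure.pi fun _ => π) ≤ K)
    (hgK : ∀ m, eLpNorm (g m) p (Measure.pi fun _ => π) ≤ K)
    (hfK : eLpNorm f p (Measure.pi fun _ => π) ≤ K)
    (hgf : ∀ D : ι → Set J, (∀ i, MeasurableSet (D i)) →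
      Tendsto (fun m => ∫⁻ x in Set.univ.pi D, g m x ∂(Measure.pi fun _ => π)) atTop
        (nhds (∫⁻ x in Set.univ.pi D, f x ∂(Measure.pi fun _ => π))))
    {B : ι → Set J} (hB : ∀ i, MeasurableSet (B i)) :
    Tendsto (fun m => ∫⁻ x in Set.univ.pi B, ∏ l, Function.update H l₀ (g m) l x
        ∂(Measure.pi fun _ => π)) atTop
      (nhds (∫⁻ x in Set.univ.pi B, ∏ l, Function.update H l₀ f l x
        ∂(Measure.pi fun _ => π))) := by
  have hp1 : (1 : ℝ≥0∞) ≤ p := by exact_mod_cast hp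
  have hK1 : K + 1 + (K + 1) ≠ ⊤ := by simp [hK]
  refine tendsto_of_forall_approx
    (C := ∑ l : κ, (K + 1 + (K + 1)) ^ (Finset.univ.erase l).card)
    (ENNReal.sum_ne_top.2 fun l _ => ENNReal.pow_ne_top hK1) fun δ hδ0 hδ1 => ?_
  choose n G hGN hG using fun l => exists_boxBits_approx π hp (hH l) (hHN l)
    ((hHK l).trans_lt hK.lt_top) hδ0
  obtain ⟨j, hj⟩ : ∃ j, ∀ l, n l ≤ j := ⟨Finset.univ.sup n, fun l => Finset.le_sup (by simp)⟩
  choose F hF using fun l => (isRefining_boxBits_const (J := J) (ι := ι)).exists_factor (hj l)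
    fun d => (G l d : NNReal)
  set H' : κ → (ι → J) → ℝ≥0∞ := fun l x => F l (boxBits (fun _ => j) x)
  have hH'eq : ∀ l x, H' l x = G l (boxBits (fun _ => n l) x) := fun l x => by
    simp only [H', ← hF]
  have hH' : ∀ l, Measurable (H' l) := fun l =>
    (Measurable.of_discrete (f := fun d => (F l d : ℝ≥0∞))).comp (measurable_boxBits _)
  have hH'N : ∀ l, DependsOn (H' l) (N l) := fun l => by
    rw [show H' l = _ from funext (hH'eq l)]
    exact hGN l
  have hHH' : ∀ l, eLpNorm (fun x => absDiff (H l x) (H' l x)) p (Measure.pi fun _ => π) ≤ δ :=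
    fun l => by simpa only [hH'eq] using hG l
  have hH'K : ∀ l, eLpNorm (H' l) p (Measure.pi fun _ => π) ≤ K + 1 := fun l => by
    refine (eLpNorm_mono_enorm (g := H l + fun x => absDiff (H l x) (H' l x)) fun x => ?_).trans
      ((eLpNorm_add_le (hH l).aestronglyMeasurable
        ((hH l).absDiff (hH' l)).aestronglyMeasurable hp1).trans
        (add_le_add (hHK l) ((hHH' l).trans hδ1)))
    simp only [enorm_eq_self, Pi.add_apply]
    rw [absDiff_comm]
    exact le_add_absDiff _ _
  have hcompare : ∀ h : (ι → J) → ℝ≥0∞, Measurable h → DependsOn h (N l₀) →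
      eLpNorm h p (Measure.pi fun _ => π) ≤ K → ∀ u v : κ → (ι → J) → ℝ≥0∞,
      (u = H ∧ v = H' ∨ u = H' ∧ v = H) →
      ∫⁻ x in Set.univ.pi B, ∏ l, Function.update u l₀ h l x ∂(Measure.pi fun _ => π) ≤
        ∫⁻ x in Set.univ.pi B, ∏ l, Function.update v l₀ h l x ∂(Measure.pi fun _ => π) +
          (∑ l : κ, (K + 1 + (K + 1)) ^ (Finset.univ.erase l).card) * δ := by
    intro h hh hhN hhK u v huv
    have hu : ∀ l, Measurable (u l) ∧ DependsOn (u l) (N l) ∧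
        eLpNorm (u l) p (Measure.pi fun _ => π) ≤ K + 1 := fun l => by
      rcases huv with ⟨rfl, -⟩ | ⟨rfl, -⟩
      exacts [⟨hH l, hHN l, (hHK l).trans le_self_add⟩, ⟨hH' l, hH'N l, hH'K l⟩]
    have hv : ∀ l, Measurable (v l) ∧ DependsOn (v l) (N l) ∧
        eLpNorm (v l) p (Measure.pi fun _ => π) ≤ K + 1 := fun l => by
      rcases huv with ⟨-, rfl⟩ | ⟨-, rfl⟩
      exacts [⟨hH' l, hH'N l, hH'K l⟩, ⟨hH l, hHN l, (hHK l).trans le_self_add⟩]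
    have hdiff : ∀ l, eLpNorm (fun x => absDiff (u l x) (v l x)) p (Measure.pi fun _ => π) ≤ δ :=
      fun l => by
        rcases huv with ⟨rfl, rfl⟩ | ⟨rfl, rfl⟩
        · exact hHH' l
        · simpa only [absDiff_comm (H' l _)] using hHH' l
    have hupd : ∀ w : κ → (ι → J) → ℝ≥0∞, (∀ l, Measurable (w l) ∧ DependsOn (w l) (N l) ∧
        eLpNorm (w l) p (Measure.pi fun _ => π) ≤ K + 1) → ∀ l,
        Measurable (Function.update w l₀ h l) ∧ DependsOn (Function.update w l₀ h l) (N l) ∧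
        eLpNorm (Function.update w l₀ h l) p (Measure.pi fun _ => π) ≤ K + 1 := by
      intro w hw l
      by_cases hl : l = l₀
      · subst hl
        simpa using ⟨hh, hhN, hhK.trans le_self_add⟩
      · simpa [hl] using hw l
    refine setLIntegral_prod_le_add_mul π hp hN (fun l => (hupd u hu l).1)
      (fun l => (hupd v hv l).1) (fun l => (hupd u hu l).2.1) (fun l => (hupd v hv l).2.1)
      (fun l => (hupd u hu l).2.2) (fun l => (hupd v hv l).2.2) (fun l => ?_) _
    by_cases hl : l = l₀
    · subst hl
      simp [absDiff_self]
    · simpa [hl] using hdiff l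
  refine ⟨fun m => ∫⁻ x in Set.univ.pi B, ∏ l, Function.update H' l₀ (g m) l x
    ∂(Measure.pi fun _ => π), ∫⁻ x in Set.univ.pi B, ∏ l, Function.update H' l₀ f l x
    ∂(Measure.pi fun _ => π), ?_,
    fun m => hcompare _ (hg m) (hgN m) (hgK m) _ _ (.inl ⟨rfl, rfl⟩),
    fun m => hcompare _ (hg m) (hgN m) (hgK m) _ _ (.inr ⟨rfl, rfl⟩),
    hcompare _ hf hfN hfK _ _ (.inl ⟨rfl, rfl⟩), hcompare _ hf hfN hfK _ _ (.inr ⟨rfl, rfl⟩)⟩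
  have hstep : ∀ h : (ι → J) → ℝ≥0∞, Measurable h →
      ∫⁻ x in Set.univ.pi B, ∏ l, Function.update H' l₀ h l x ∂(Measure.pi fun _ => π) =
      ∑ d, (∏ l ∈ Finset.univ.erase l₀, (F l d : ℝ≥0∞)) *
        ∫⁻ x in Set.univ.pi fun i => bits j ⁻¹' {d i} ∩ B i, h x ∂(Measure.pi fun _ => π) := by
    intro h hh
    rw [← setLIntegral_boxBits_mul π j (fun d => ∏ l ∈ Finset.univ.erase l₀, (F l d : ℝ≥0∞)) h hh
      hB]
    refine lintegral_congr fun x => ?_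
    rw [← Finset.prod_erase_mul _ _ (Finset.mem_univ l₀)]
    congr 1
    · exact Finset.prod_congr rfl fun l hl => by simp [H', Finset.ne_of_mem_erase hl]
    · simp
  simp_rw [hstep _ (hg _), hstep _ hf]
  refine tendsto_finsetSum _ fun d _ => ENNReal.Tendsto.const_mul ?_ (.inr ?_)
  · exact hgf _ fun i => (measurable_bits j (measurableSet_singleton _)).inter (hB i)
  · exact ENNReal.prod_ne_top fun l _ => ENNReal.coe_ne_top

end Products

theorem isReversible_of_map_swap {P : Kernel J J} {η : Measure (J × J)} (hsym : η.map Prod.swap = η)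
    (hP : ∀ A B : Set J, MeasurableSet A → MeasurableSet B →
      η (A ×ˢ B) = ∫⁻ x in A, P x B ∂(η.map Prod.fst)) :
    P.IsReversible (η.map Prod.fst) := by
  intro A B hA hB
  rw [← hP A B hA hB, ← hP B A hB hA]
  conv_lhs => rw [← hsym]
  rw [Measure.map_apply measurable_swap (hA.prod hB), Set.preimage_swap_prod]

theorem eLpNorm_natCast_le {X : Type*} [MeasurableSpace X] (μ : Measure X) {f : X → ℝ≥0∞} {p : ℕ}
    (hp : 1 ≤ p) {C : ℝ≥0∞} (h : ∫⁻ x, f x ^ p ∂μ ≤ C) :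
    eLpNorm f p μ ≤ C ^ (1 / (p : ℝ)) := by
  rw [eLpNorm_natCast_eq μ f hp]
  exact ENNReal.rpow_le_rpow h (by positivity)

section Symmetry

variable {ι κ : Type*} [Fintype ι] [DecidableEq ι] [Fintype κ] [DecidableEq κ]
  {π : Measure J} [IsProbabilityMeasure π] {P : Kernel J J} [MeasurableSpace.CountablyGenerated J]

theorem tendsto_setLIntegral_prod_leafAvg {N : κ → Finset ι} {p : ℕ} (hp : 1 ≤ p)
    (hN : ∀ i, (Finset.univ.filter fun l => i ∈ N l).card ≤ p) {B : κ → Set J}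
    {f : κ → (ι → J) → ℝ≥0∞} (hf : ∀ l, IsStar π P (N l) (B l) (f l)) {K : ℝ≥0∞} (hK : K ≠ ⊤)
    (hfK : ∀ l, eLpNorm (f l) p (Measure.pi fun _ => π) ≤ K) (S : Set (ι → J)) :
    Tendsto (fun n => ∫⁻ x in S, ∏ l, leafAvg π P (N l) (B l) n x ∂(Measure.pi fun _ => π)) atTop
      (nhds (∫⁻ x in S, ∏ l, f l x ∂(Measure.pi fun _ => π))) := by
  set μ : Measure (ι → J) := Measure.pi fun _ => π
  set δ : κ → (ι → ℕ) → ℝ≥0∞ := fun l n =>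
    eLpNorm (fun x => absDiff (leafAvg π P (N l) (B l) n x) (f l x)) p μ
  have hcell : ∀ l n, cellAvg μ (boxBits n) (f l) =ᵐ[μ] leafAvg π P (N l) (B l) n := fun l n =>
    (hf l).cellAvg_ae n
  have hδ : ∀ l, Tendsto (δ l) atTop (nhds 0) := fun l => by
    refine (isRefining_boxBits.tendsto_eLpNorm_absDiff μ hp (hf l).measurable
      ((hfK l).trans_lt hK.lt_top)).congr fun n => eLpNorm_congr_ae ?_
    filter_upwards [hcell l n] with x hx
    rw [hx]
  have havgK : ∀ n l, eLpNorm (leafAvg π P (N l) (B l) n) p μ ≤ K := fun n l => by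
    rw [← eLpNorm_congr_ae (hcell l n)]
    exact (eLpNorm_cellAvg_le μ (measurable_boxBits n) (hf l).measurable hp).trans (hfK l)
  have hδle : ∀ n l, δ l n ≤ ∑ l, δ l n := fun n l =>
    Finset.single_le_sum (f := fun l => δ l n) (fun _ _ => zero_le) (Finset.mem_univ l)
  have hlim : Tendsto (fun n => (∑ l : κ, (K + K) ^ (Finset.univ.erase l).card) * ∑ l, δ l n) atTop
      (nhds 0) := by
    have h : Tendsto (fun n => ∑ l, δ l n) atTop (nhds (∑ _l : κ, 0)) :=
      tendsto_finsetSum _ fun l _ => hδ l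
    have := ENNReal.Tendsto.const_mul (a := ∑ l : κ, (K + K) ^ (Finset.univ.erase l).card) h
      (.inr (ENNReal.sum_ne_top.2 fun l _ => ENNReal.pow_ne_top (by simp [hK])))
    simpa using this
  refine tendsto_of_le_add (fun n => ?_) (fun n => ?_) hlim
  · exact setLIntegral_prod_le_add_mul π hp hN (fun l => measurable_leafAvg _ _ _)
      (fun l => (hf l).measurable) (fun l => dependsOn_leafAvg _ _ _) (fun l => (hf l).dependsOn)
      (havgK n) hfK (hδle n) S
  · refine setLIntegral_prod_le_add_mul π hp hN (fun l => (hf l).measurable)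
      (fun l => measurable_leafAvg _ _ _) (fun l => (hf l).dependsOn)
      (fun l => dependsOn_leafAvg _ _ _) hfK (havgK n) (fun l => ?_) S
    simp_rw [absDiff_comm (f l _)]
    exact hδle n l

/-- Integrating products of star densities over the left or the right vertices of a bigraph gives
the same result, provided both sides have enough moments. -/
theorem setLIntegral_prod_isStar_comm [IsMarkovKernel P] (hrev : P.IsReversible π)
    {N : κ → Finset ι} {M : ι → Finset κ} (hNM : ∀ i l, i ∈ N l ↔ l ∈ M i) {k p : ℕ}
    (hk : 1 ≤ k) (hp : 1 ≤ p) (hNk : ∀ l, (N l).card ≤ k) (hMp : ∀ i, (M i).card ≤ p)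
    {A : ι → Set J} {B : κ → Set J} (hA : ∀ i, MeasurableSet (A i)) (hB : ∀ l, MeasurableSet (B l))
    {f : κ → (ι → J) → ℝ≥0∞} (hf : ∀ l, IsStar π P (N l) (B l) (f l))
    {g : ι → (κ → J) → ℝ≥0∞} (hg : ∀ i, IsStar π P (M i) (A i) (g i))
    {K K' : ℝ≥0∞} (hK : K ≠ ⊤) (hK' : K' ≠ ⊤)
    (hfK : ∀ l, eLpNorm (f l) p (Measure.pi fun _ => π) ≤ K)
    (hgK : ∀ i, eLpNorm (g i) k (Measure.pi fun _ => π) ≤ K')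
    (havgK : ∀ i m, eLpNorm (centreAvg π P (M i) (A i) m) k (Measure.pi fun _ => π) ≤ K') :
    ∫⁻ x in Set.univ.pi A, ∏ l, f l x ∂(Measure.pi fun _ => π) =
      ∫⁻ y in Set.univ.pi B, ∏ i, g i y ∂(Measure.pi fun _ => π) := by
  have hN : ∀ i, (Finset.univ.filter fun l => i ∈ N l).card ≤ p := fun i => by
    simpa [hNM] using hMp i
  have hM : ∀ l, (Finset.univ.filter fun i => l ∈ M i).card ≤ k := fun l => by
    simpa [← hNM] using hNk l
  set L := ∫⁻ x in Set.univ.pi A, ∏ l, f l x ∂(Measure.pi fun _ => π)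
  let H : Finset ι → (ι → ℕ) → ι → (κ → J) → ℝ≥0∞ := fun S n i =>
    if i ∈ S then g i else centreAvg π P (M i) (A i) (n i)
  have hH : ∀ S n i, Measurable (H S n i) ∧ DependsOn (H S n i) (M i) ∧
      eLpNorm (H S n i) k (Measure.pi fun _ => π) ≤ K' := fun S n i => by
    simp only [H]
    split_ifs
    exacts [⟨(hg i).measurable, (hg i).dependsOn, hgK i⟩,
      ⟨measurable_centreAvg _ _ _, dependsOn_centreAvg _ _ _, havgK i _⟩]
  have key : ∀ S : Finset ι, Tendsto
      (fun n => ∫⁻ y in Set.univ.pi B, ∏ i, H S n i y ∂(Measure.pi fun _ => π)) atTop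
      (nhds L) := by
    intro S
    induction S using Finset.induction_on with
    | empty =>
      refine (tendsto_setLIntegral_prod_leafAvg hp hN hf hK hfK (Set.univ.pi A)).congr fun n => ?_
      simpa [H, leafAvg, centreAvg] using lintegral_prod_lintegral_comm π hNM
        (V := fun i => stepKernel π P (n i)) (fun i => measurable_stepKernel _) hA hB
    | insert u S hu ih =>
      refine (closed_nhds_basis L).tendsto_right_iff.2 fun V hV => ?_
      obtain ⟨n₀, hn₀⟩ := eventually_atTop.1 (ih.eventually hV.1)
      filter_upwards [eventually_ge_atTop n₀] with n hn
      have hlim := tendsto_setLIntegral_prod_update π hk hM (fun i => (hH S n i).1)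
        (fun i => (hH S n i).2.1) u (fun m => measurable_centreAvg (M u) (A u) m) (hg u).measurable
        (fun m => dependsOn_centreAvg _ _ m) (hg u).dependsOn hK' (fun i => (hH S n i).2.2)
        (havgK u) (hgK u) (fun D hD => (hg u).tendsto_setLIntegral_centreAvg hrev hD) hB
      have hleft : ∀ m, Function.update (H S n) u (centreAvg π P (M u) (A u) m) =
          H S (Function.update n u m) := fun m => by
        funext i
        by_cases hi : i = u
        · subst hi; simp [H, hu]
        · simp [H, hi]
      have hright : Function.update (H S n) u (g u) = H (insert u S) n := by
        funext i
        by_cases hi : i = u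
        · subst hi; simp [H]
        · simp [H, hi]
      simp_rw [hleft, hright] at hlim
      refine hV.2.mem_of_tendsto hlim ?_
      filter_upwards [eventually_ge_atTop (n₀ u)] with m hm
      refine hn₀ _ fun i => ?_
      by_cases hi : i = u
      · subst hi; simpa using hm
      · simpa [hi] using hn i
  have h := key Finset.univ
  simp only [H, Finset.mem_univ, if_true] at h
  exact tendsto_nhds_unique tendsto_const_nhds h |>.symm

theorem lintegral_centreAvg_le_one [IsMarkovKernel P] (hrev : P.IsReversible π) (M : Finset κ)
    (A : Set J) (m : ℕ) : ∫⁻ y, centreAvg π P M A m y ∂(Measure.pi fun _ => π) ≤ 1 := by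
  have h := setLIntegral_centreAvg hrev M A m (D := fun _ => Set.univ) fun _ => .univ
  simp only [Set.pi_univ, Measure.restrict_univ, measure_univ, Finset.prod_const_one,
    one_mul] at h
  rw [h]
  calc _ ≤ ∫⁻ _ in A, 1 ∂π := lintegral_mono fun x =>
        Finset.prod_le_one' fun l _ => by simpa using cellAvg_bits_le_one (P := P) m Set.univ x
    _ ≤ 1 := by simpa using prob_le_one

end Symmetry

/-- **Theorem (`η^G = η^{G*}`).**
Let `(J, η)` be a `(k,p)`-loose Markov space and `G = (U, W, E)` a bigraph with `deg(w) ≤ k`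
for all `w ∈ W` and `deg(u) ≤ p` for all `u ∈ U`.  Let `ψ` (resp. `φ`) be star disintegration
families attached to the right (resp. left) vertices.  Then the homomorphism measure defined
by integrating over `J^U` the product of the `ψ` measures coincides on all measurable boxes
with the one defined by integrating over `J^W` the product of the `φ` measures:
`∫_{∏ A_u} ∏_w ψ_{x|N(w)}(B_w) dπ^U(x) = ∫_{∏ B_w} ∏_u φ_{y|N(u)}(A_u) dπ^W(y)`. -/
theorem homMeasure_symm
    {U W' : Type*} [Fintype U] [Fintype W'] [DecidableEq U] [DecidableEq W']
    [StandardBorelSpace J]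
    (η : Measure (J × J)) [IsProbabilityMeasure η]
    (hsym : η.map Prod.swap = η)
    (P : Kernel J J) [IsMarkovKernel P]
    (hP : ∀ A B : Set J, MeasurableSet A → MeasurableSet B →
      η (A ×ˢ B) = ∫⁻ x in A, P x B ∂(η.map Prod.fst))
    (k p : ℕ) (hloose : KPLoose (η.map Prod.fst) P k p)
    (E : Finset (U × W'))
    (hdegW : ∀ w : W', (nbrW E w).card ≤ k) (hdegU : ∀ u : U, (nbrU E u).card ≤ p)
    (ψ : ∀ w : W', Kernel (↥(nbrW E w) → J) J)
    (hψ : ∀ w : W', IsStarDisint (η.map Prod.fst) P (ψ w))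
    (φ : ∀ u : U, Kernel (↥(nbrU E u) → J) J)
    (hφ : ∀ u : U, IsStarDisint (η.map Prod.fst) P (φ u)) :
    ∀ (A : U → Set J) (B : W' → Set J),
      (∀ u, MeasurableSet (A u)) → (∀ w, MeasurableSet (B w)) →
      ∫⁻ x : U → J in Set.univ.pi A, ∏ w : W', ψ w (fun u => x u.1) (B w)
          ∂(Measure.pi fun _ : U => η.map Prod.fst)
        = ∫⁻ y : W' → J in Set.univ.pi B, ∏ u : U, φ u (fun w => y w.1) (A u)
          ∂(Measure.pi fun _ : W' => η.map Prod.fst) := by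
  classical
  set π := η.map Prod.fst
  have : IsProbabilityMeasure π := Measure.isProbabilityMeasure_map measurable_fst.aemeasurable
  intro A B hA hB
  have hrev : P.IsReversible π := isReversible_of_map_swap hsym hP
  have hs := hloose.1.isStar
  set s := stepDensityIdx π P (Fin k)
  have hf : ∀ w, IsStar π P (nbrW E w) (B w) fun x => ψ w (fun u => x u.1) (B w) := fun w =>
    (hψ w).isStar (hB w)
  have hg : ∀ u, IsStar π P (nbrU E u) (A u) fun y => φ u (fun w => y w.1) (A u) := fun u =>
    (hφ u).isStar (hA u)
  set Q : ℝ≥0∞ := 1 + (1 + ∫⁻ x, s x ^ max p 1 ∂(Measure.pi fun _ => π))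
  have hQ : Q ≠ ⊤ := by
    suffices ∫⁻ x, s x ^ max p 1 ∂(Measure.pi fun _ => π) ≠ ⊤ by simp [Q, this]
    rcases le_total p 1 with h | h
    · rw [max_eq_right h]
      simpa using (hs.lintegral_le_one.trans_lt ENNReal.one_lt_top).ne
    · rw [max_eq_left h]
      exact hloose.2.ne
  have hcentre : ∀ u m,
      ∫⁻ y, centreAvg π P (nbrU E u) (A u) m y ^ max k 1 ∂(Measure.pi fun _ => π) ≤ Q := by
    intro u m
    rcases le_total k 1 with h | h
    · rw [max_eq_right h]
      simp only [pow_one]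
      exact (lintegral_centreAvg_le_one hrev _ _ m).trans le_self_add
    · rw [max_eq_left h]
      exact (lintegral_centreAvg_pow_le hs (hA u) ((hdegU u).trans (le_max_left p 1)) m).trans
        le_add_self
  have hroot : ∀ r : ℕ, Q ^ (1 / (r : ℝ)) ≠ ⊤ := fun r =>
    ENNReal.rpow_ne_top_of_nonneg (by positivity) hQ
  exact setLIntegral_prod_isStar_comm hrev (fun u w => by simp [nbrW, nbrU])
    (le_max_right k 1) (le_max_right p 1) (fun w => (hdegW w).trans (le_max_left k 1))
    (fun u => (hdegU u).trans (le_max_left p 1)) hA hB hf hg (hroot _) (hroot _)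
    (fun w => eLpNorm_natCast_le _ (le_max_right p 1)
      (hs.lintegral_pow_le (hdegW w) (hB w) (hf w)))
    (fun u => eLpNorm_natCast_le _ (le_max_right k 1)
      ((hg u).lintegral_pow_le_of_centreAvg hrev (hcentre u)))
    fun u m => eLpNorm_natCast_le _ (le_max_right k 1) (hcentre u m)
end

section
/- Let (J,𝓑,η) be a k-loose Markov space and (W_n)_{n≥1} a sequence of 1-regular graphons on (J,𝓑,π) such that η is the k-limit of (W_n): s_k^{W_n}(x) → s_k^η(x) for π^k-almost all x∈J^k, and there is a constant C>0 such that s_k^{W_n} ≤ C·s_k^η π^k-almost everywhere for every n, where s_k^W(y_1,…,y_k) := ∫_J ∏_{i=1}^k W(x,y_i) dπ(x). Let G=(U,W,E) be a bigraph with deg(w)≤k for all w∈W, and assume t(G,η) < ∞. Then t(G,W_n) → t(G,η) as n→∞. -/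
open MeasureTheory ProbabilityTheory Finset Filter
open scoped ENNReal

variable {J : Type*} [MeasurableSpace J]

/-- The star density of a graphon `W` over a finite index type `ι`:
`s_ι^W(y) = ∫ ∏_{i} W(x, y_i) dπ(x)`. -/
noncomputable def sGraphon (π : Measure J) (W : J → J → ℝ≥0∞) (ι : Type*) [Fintype ι] :
    (ι → J) → ℝ≥0∞ :=
  fun y => ∫⁻ x, ∏ i : ι, W x (y i) ∂π

/-- The homomorphism density `t(G, W)` of the bigraph `G = (U, W', E)` in a graphon `W`. -/
noncomputable def tGraphon {U W' : Type*} [Fintype U] [Fintype W']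
    (π : Measure J) (W : J → J → ℝ≥0∞) (E : Finset (U × W')) : ℝ≥0∞ :=
  ∫⁻ x : U → J, ∫⁻ y : W' → J, ∏ e ∈ E, W (x e.1) (y e.2)
    ∂(Measure.pi fun _ : W' => π) ∂(Measure.pi fun _ : U => π)

/-- The homomorphism density `t(G, η)` of the bigraph `G = (U, W', E)` in the Markov space
with stationary distribution `π` and kernel `P`:
`t(G,η) = ∫_{J^U} ∏_{w ∈ W'} s_{deg w}(x|_{N(w)}) dπ^U(x)`. -/
noncomputable def tEta {U W' : Type*} [Fintype U] [Fintype W'] [DecidableEq U] [DecidableEq W']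
    (π : Measure J) (P : Kernel J J) (E : Finset (U × W')) : ℝ≥0∞ :=
  ∫⁻ x : U → J, ∏ w : W', stepDensityIdx π P (↥(nbrW E w)) (fun u => x u.1)
    ∂(Measure.pi fun _ : U => π)

section StarDensities

variable {ι κ ν : Type*} [Fintype ι] [Fintype κ] [Fintype ν]

/-- Restricting the coordinates of an i.i.d. family along an injection yields an i.i.d. family. -/
lemma measurePreserving_pi_comp_injective (π : Measure J) [IsProbabilityMeasure π]
    {f : ι → ν} (hf : Function.Injective f) :
    MeasurePreserving (fun (z : ν → J) i => z (f i))
      (Measure.pi fun _ : ν => π) (Measure.pi fun _ : ι => π) := by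
  refine ⟨by fun_prop, ?_⟩
  have h : iIndepFun (fun (i : ν) (ω : ν → J) => ω i) (Measure.pi fun _ : ν => π) :=
    iIndepFun_pi (X := fun _ => id) fun _ => aemeasurable_id
  rw [(iIndepFun_iff_map_fun_eq_pi_map fun i => (measurable_pi_apply (f i)).aemeasurable).1
    (h.precomp hf)]
  congr with i : 1
  exact (measurePreserving_eval (fun _ : ν => π) (f i)).map_eq

/-- Splitting the index set of an i.i.d. family in two. -/
lemma measurePreserving_sumElim_comp_symm (π : Measure J) [IsProbabilityMeasure π]
    (e : ι ⊕ κ ≃ ν) :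
    MeasurePreserving (fun (p : (ι → J) × (κ → J)) j => Sum.elim p.1 p.2 (e.symm j))
      ((Measure.pi fun _ : ι => π).prod (Measure.pi fun _ : κ => π))
      (Measure.pi fun _ : ν => π) := by
  have h := (measurePreserving_pi_comp_injective π e.symm.injective).comp
    (measurePreserving_sumPiEquivProdPi_symm fun _ : ι ⊕ κ => π)
  convert! h using 1

lemma lintegral_pi_prod_eq_prod_lintegral (π : Measure J) [IsProbabilityMeasure π]
    {f : ι → J → ℝ≥0∞} (hf : ∀ i, Measurable (f i)) :
    ∫⁻ z, ∏ i, f i (z i) ∂(Measure.pi fun _ : ι => π) = ∏ i, ∫⁻ x, f i x ∂π := by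
  rw [lintegral_prod_eq_prod_lintegral_of_indepFun Finset.univ
    (fun i (z : ι → J) => f i (z i)) (iIndepFun_pi fun i => (hf i).aemeasurable)
    fun i => (hf i).comp (measurable_pi_apply i)]
  exact Finset.prod_congr rfl fun i _ =>
    (measurePreserving_eval (fun _ : ι => π) i).lintegral_comp (hf i)

lemma measurable_pi_kernel (P : Kernel J J) [IsMarkovKernel P] :
    Measurable fun x => Measure.pi fun _ : ι => P x := by
  refine Measurable.measure_of_isPiSystem_of_isProbabilityMeasure generateFrom_pi.symm
    isPiSystem_pi ?_
  rintro _ ⟨s, hs, rfl⟩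
  simp_rw [Measure.pi_pi]
  exact Finset.measurable_prod _ fun i _ => P.measurable_coe (hs i (Set.mem_univ i))

instance isProbabilityMeasure_stepMeasureIdx (π : Measure J) [IsProbabilityMeasure π]
    (P : Kernel J J) [IsMarkovKernel P] : IsProbabilityMeasure (stepMeasureIdx π P ι) :=
  ⟨by simp [stepMeasureIdx, Measure.bind_apply MeasurableSet.univ
    (measurable_pi_kernel P).aemeasurable]⟩

lemma measurable_stepDensityIdx (π : Measure J) (P : Kernel J J) :
    Measurable (stepDensityIdx π P ι) :=
  Measure.measurable_rnDeriv _ _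

lemma measurable_sGraphon (π : Measure J) [SFinite π] {W : J → J → ℝ≥0∞}
    (hW : Measurable (Function.uncurry W)) : Measurable (sGraphon π W ι) := by
  refine Measurable.lintegral_prod_left' (f := fun p : J × (ι → J) => ∏ i, W p.1 (p.2 i)) ?_
  exact Finset.measurable_prod _ fun i _ =>
    hW.comp (measurable_fst.prodMk ((measurable_pi_apply i).comp measurable_snd))

lemma stepMeasureIdx_preimage_comp (π : Measure J) (P : Kernel J J) [IsMarkovKernel P]
    {f : ι → ν} (hf : Function.Injective f) {A : Set (ι → J)} (hA : MeasurableSet A) :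
    stepMeasureIdx π P ν ((fun z i => z (f i)) ⁻¹' A) = stepMeasureIdx π P ι A := by
  rw [stepMeasureIdx, stepMeasureIdx,
    Measure.bind_apply (measurableSet_preimage (by fun_prop) hA)
      (measurable_pi_kernel P).aemeasurable,
    Measure.bind_apply hA (measurable_pi_kernel P).aemeasurable]
  exact lintegral_congr fun x =>
    (measurePreserving_pi_comp_injective (P x) hf).measure_preimage hA.nullMeasurableSet

/-- The star densities of a loose Markov space are obtained from one another by integrating out
coordinates. -/
lemma lintegral_stepDensityIdx_sumElim (π : Measure J) [IsProbabilityMeasure π]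
    (P : Kernel J J) [IsMarkovKernel P] (e : ι ⊕ κ ≃ ν)
    (hac : stepMeasureIdx π P ν ≪ Measure.pi fun _ : ν => π) :
    (fun y => ∫⁻ z, stepDensityIdx π P ν (fun j => Sum.elim y z (e.symm j))
        ∂(Measure.pi fun _ : κ => π))
      =ᵐ[Measure.pi fun _ : ι => π] stepDensityIdx π P ι := by
  have hφ := measurePreserving_sumElim_comp_symm π e
  have hs : Measurable (stepDensityIdx π P ν) := measurable_stepDensityIdx π P
  have hmeas : Measurable fun p : (ι → J) × (κ → J) =>
      stepDensityIdx π P ν (fun j => Sum.elim p.1 p.2 (e.symm j)) := hs.comp hφ.measurable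
  refine Measure.eq_rnDeriv (s := 0) hmeas.lintegral_prod_right' Measure.MutuallySingular.zero_left
    ?_
  rw [zero_add]
  ext A hA
  have hf : Function.Injective fun i : ι => e (Sum.inl i) := e.injective.comp Sum.inl_injective
  have hA' : MeasurableSet ((fun (z : ν → J) i => z (e (Sum.inl i))) ⁻¹' A) :=
    measurableSet_preimage (by fun_prop) hA
  rw [← stepMeasureIdx_preimage_comp π P hf hA, ← Measure.withDensity_rnDeriv_eq _ _ hac,
    withDensity_apply _ hA', withDensity_apply _ hA]
  change ∫⁻ z in _, stepDensityIdx π P ν z ∂_ = _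
  rw [← hφ.setLIntegral_comp_preimage hA' hs]
  have hpre : (fun (p : (ι → J) × (κ → J)) j => Sum.elim p.1 p.2 (e.symm j)) ⁻¹'
      ((fun (z : ν → J) i => z (e (Sum.inl i))) ⁻¹' A) = A ×ˢ Set.univ := by
    ext p
    simp
  rw [hpre, ← Measure.prod_restrict, Measure.restrict_univ, lintegral_prod _ hmeas.aemeasurable]

/-- The star densities of a `1`-regular graphon are obtained from one another by integrating out
coordinates. -/
lemma lintegral_sGraphon_sumElim (π : Measure J) [IsProbabilityMeasure π] {W : J → J → ℝ≥0∞}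
    (hW : Measurable (Function.uncurry W)) (hreg : ∀ᵐ x ∂π, ∫⁻ y, W x y ∂π = 1)
    (e : ι ⊕ κ ≃ ν) (y : ι → J) :
    ∫⁻ z, sGraphon π W ν (fun j => Sum.elim y z (e.symm j)) ∂(Measure.pi fun _ : κ => π)
      = sGraphon π W ι y := by
  have hsplit : ∀ (x : J) (z : κ → J), ∏ j, W x (Sum.elim y z (e.symm j))
      = (∏ i, W x (y i)) * ∏ l, W x (z l) := fun x z => by
    rw [e.symm.prod_comp fun s => W x (Sum.elim y z s), Fintype.prod_sum_type]
    rfl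
  have hz : Measurable fun p : (κ → J) × J => ∏ l, W p.2 (p.1 l) :=
    Finset.measurable_prod _ fun l _ =>
      hW.comp (measurable_snd.prodMk ((measurable_pi_apply l).comp measurable_fst))
  have hy : Measurable fun x => ∏ i, W x (y i) :=
    Finset.measurable_prod _ fun i _ => hW.comp (measurable_id.prodMk measurable_const)
  simp_rw [sGraphon, hsplit]
  rw [lintegral_lintegral_swap ((hy.comp measurable_snd).mul hz).aemeasurable]
  refine lintegral_congr_ae ?_
  filter_upwards [hreg] with x hx
  have hWx : Measurable (W x) := hW.of_uncurry_left
  have hzx : Measurable fun z : κ → J => ∏ l, W x (z l) :=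
    hz.comp (measurable_id.prodMk measurable_const)
  rw [lintegral_const_mul _ hzx,
    lintegral_pi_prod_eq_prod_lintegral π fun _ => hWx]
  simp [hx]

lemma ae_prod_of_ae_sumElim {π : Measure J} [IsProbabilityMeasure π] (e : ι ⊕ κ ≃ ν)
    {p : (ν → J) → Prop} (hp : ∀ᵐ z ∂(Measure.pi fun _ : ν => π), p z) :
    ∀ᵐ y ∂(Measure.pi fun _ : ι => π), ∀ᵐ z ∂(Measure.pi fun _ : κ => π),
      p fun j => Sum.elim y z (e.symm j) :=
  Measure.ae_ae_of_ae_prod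
    ((measurePreserving_sumElim_comp_symm π e).quasiMeasurePreserving.ae hp)

/-- Domination of star densities passes to smaller stars. -/
lemma sGraphon_le_of_sumElim {π : Measure J} [IsProbabilityMeasure π]
    {P : Kernel J J} [IsMarkovKernel P] {W : J → J → ℝ≥0∞}
    (hW : Measurable (Function.uncurry W)) (hreg : ∀ᵐ x ∂π, ∫⁻ y, W x y ∂π = 1)
    (e : ι ⊕ κ ≃ ν) (hac : stepMeasureIdx π P ν ≪ Measure.pi fun _ : ν => π) {C : ℝ≥0∞}
    (hdom : ∀ᵐ z ∂(Measure.pi fun _ : ν => π), sGraphon π W ν z ≤ C * stepDensityIdx π P ν z) :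
    ∀ᵐ y ∂(Measure.pi fun _ : ι => π), sGraphon π W ι y ≤ C * stepDensityIdx π P ι y := by
  filter_upwards [ae_prod_of_ae_sumElim e hdom, lintegral_stepDensityIdx_sumElim π P e hac]
    with y hy hs
  have hsy : Measurable fun z : κ → J =>
      stepDensityIdx π P ν (fun j => Sum.elim y z (e.symm j)) :=
    (measurable_stepDensityIdx π P).comp
      ((measurePreserving_sumElim_comp_symm π e).measurable.comp measurable_prodMk_left)
  rw [← lintegral_sGraphon_sumElim π hW hreg e y, ← hs,
    ← lintegral_const_mul _ hsy]
  exact lintegral_mono_ae hy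

/-- Dominated convergence of star densities passes to smaller stars. -/
lemma tendsto_sGraphon_of_sumElim {π : Measure J} [IsProbabilityMeasure π]
    {P : Kernel J J} [IsMarkovKernel P] {W : ℕ → J → J → ℝ≥0∞}
    (hW : ∀ n, Measurable (Function.uncurry (W n)))
    (hreg : ∀ n, ∀ᵐ x ∂π, ∫⁻ y, W n x y ∂π = 1)
    (e : ι ⊕ κ ≃ ν) (hac : stepMeasureIdx π P ν ≪ Measure.pi fun _ : ν => π)
    {C : ℝ≥0∞} (hC : C ≠ ⊤)
    (hdom : ∀ n, ∀ᵐ z ∂(Measure.pi fun _ : ν => π),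
      sGraphon π (W n) ν z ≤ C * stepDensityIdx π P ν z)
    (hlim : ∀ᵐ z ∂(Measure.pi fun _ : ν => π),
      Tendsto (fun n => sGraphon π (W n) ν z) atTop (nhds (stepDensityIdx π P ν z))) :
    ∀ᵐ y ∂(Measure.pi fun _ : ι => π),
      Tendsto (fun n => sGraphon π (W n) ι y) atTop (nhds (stepDensityIdx π P ι y)) := by
  filter_upwards [ae_prod_of_ae_sumElim e (ae_all_iff.2 hdom), ae_prod_of_ae_sumElim e hlim,
    lintegral_stepDensityIdx_sumElim π P e hac,
    Measure.rnDeriv_lt_top (stepMeasureIdx π P ι) (Measure.pi fun _ : ι => π)]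
    with y hy hylim hs hfin
  have hφy : Measurable fun (z : κ → J) j => Sum.elim y z (e.symm j) :=
    (measurePreserving_sumElim_comp_symm π e).measurable.comp measurable_prodMk_left
  have hsy : Measurable fun z : κ → J =>
      stepDensityIdx π P ν (fun j => Sum.elim y z (e.symm j)) :=
    (measurable_stepDensityIdx π P).comp hφy
  simp_rw [← lintegral_sGraphon_sumElim π (hW _) (hreg _) e y]
  rw [← hs]
  refine tendsto_lintegral_of_dominated_convergence
    (fun z => C * stepDensityIdx π P ν (fun j => Sum.elim y z (e.symm j)))
    (fun n => (measurable_sGraphon π (hW n)).comp hφy) (fun n => ?_) ?_ hylim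
  · filter_upwards [hy] with z hz using hz n
  · rw [lintegral_const_mul _ hsy, hs]
    exact ENNReal.mul_ne_top hC hfin.ne

end StarDensities

/-- The density of a bigraph in a graphon, expressed through star densities. -/
lemma tGraphon_eq_lintegral_prod_sGraphon {U W' : Type*} [Fintype U] [Fintype W']
    [DecidableEq U] [DecidableEq W'] (π : Measure J) [IsProbabilityMeasure π]
    {W : J → J → ℝ≥0∞} (hW : Measurable (Function.uncurry W)) (hsym : ∀ x y, W x y = W y x)
    (E : Finset (U × W')) :
    tGraphon π W E
      = ∫⁻ x : U → J, ∏ w : W', sGraphon π W (↥(nbrW E w)) (fun u => x u.1)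
          ∂(Measure.pi fun _ : U => π) := by
  refine lintegral_congr fun x => ?_
  have hprod : ∀ y : W' → J, ∏ e ∈ E, W (x e.1) (y e.2)
      = ∏ w, ∏ u : ↥(nbrW E w), W (y w) (x u.1) := fun y => by
    rw [Finset.prod_finset_product_right' E Finset.univ (nbrW E) (by simp [nbrW])
      (f := fun u w => W (x u) (y w))]
    refine Finset.prod_congr rfl fun w _ => ?_
    rw [← Finset.prod_coe_sort]
    exact Finset.prod_congr rfl fun u _ => hsym _ _
  simp_rw [hprod]
  exact lintegral_pi_prod_eq_prod_lintegral π
    (f := fun w a => ∏ u : ↥(nbrW E w), W a (x u.1)) fun w =>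
    Finset.measurable_prod _ fun u _ => hW.comp (measurable_id.prodMk measurable_const)

/-- **Theorem (densities converge along `k`-limits of graphons).**
Let `(J, η)` be a `k`-loose Markov space, and let `(W_n)` be a sequence of `1`-regular
graphons on `(J, π)` such that `η` is the `k`-limit of `(W_n)`: `s_k^{W_n} → s_k^η`
`π^k`-almost everywhere, and `s_k^{W_n} ≤ C · s_k^η` a.e. for a constant `C` independent
of `n`.  Let `G = (U, W, E)` be a bigraph with `deg(w) ≤ k` for all `w ∈ W`, and assume
`t(G, η) < ∞`.  Then `t(G, W_n) → t(G, η)`. -/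
theorem tendsto_tGraphon_of_kLimit
    {U W' : Type*} [Fintype U] [Fintype W'] [DecidableEq U] [DecidableEq W']
    [StandardBorelSpace J]
    (η : Measure (J × J)) [IsProbabilityMeasure η]
    (hsym : η.map Prod.swap = η)
    (P : Kernel J J) [IsMarkovKernel P]
    (hP : ∀ A B : Set J, MeasurableSet A → MeasurableSet B →
      η (A ×ˢ B) = ∫⁻ x in A, P x B ∂(η.map Prod.fst))
    (k : ℕ) (hloose : KLoose (η.map Prod.fst) P k)
    (Wn : ℕ → J → J → ℝ≥0∞)
    (hWmeas : ∀ n, Measurable (Function.uncurry (Wn n)))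
    (hWsym : ∀ n x y, Wn n x y = Wn n y x)
    (hWreg : ∀ n, ∀ᵐ x ∂(η.map Prod.fst), ∫⁻ y, Wn n x y ∂(η.map Prod.fst) = 1)
    (hae : ∀ᵐ z ∂(Measure.pi fun _ : Fin k => η.map Prod.fst),
      Tendsto (fun n => sGraphon (η.map Prod.fst) (Wn n) (Fin k) z) atTop
        (nhds (stepDensityIdx (η.map Prod.fst) P (Fin k) z)))
    (C : ℝ≥0∞) (hC : C ≠ ⊤)
    (hdom : ∀ n, ∀ᵐ z ∂(Measure.pi fun _ : Fin k => η.map Prod.fst),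
      sGraphon (η.map Prod.fst) (Wn n) (Fin k) z
        ≤ C * stepDensityIdx (η.map Prod.fst) P (Fin k) z)
    (E : Finset (U × W'))
    (hdegW : ∀ w : W', (nbrW E w).card ≤ k)
    (hfin : tEta (η.map Prod.fst) P E < ⊤) :
    Tendsto (fun n => tGraphon (η.map Prod.fst) (Wn n) E) atTop
      (nhds (tEta (η.map Prod.fst) P E)) := by
  have hprob : IsProbabilityMeasure (η.map Prod.fst) :=
    Measure.isProbabilityMeasure_map measurable_fst.aemeasurable
  generalize η.map Prod.fst = π at *
  have hequiv : ∀ w, Nonempty (↥(nbrW E w) ⊕ Fin (k - (nbrW E w).card) ≃ Fin k) := fun w =>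
    Fintype.card_eq.1 (by simp [Nat.add_sub_cancel' (hdegW w)])
  have hrestrict : ∀ w, MeasurePreserving (fun (x : U → J) (u : ↥(nbrW E w)) => x u.1)
      (Measure.pi fun _ : U => π) (Measure.pi fun _ : ↥(nbrW E w) => π) := fun w =>
    measurePreserving_pi_comp_injective π Subtype.val_injective
  simp_rw [tGraphon_eq_lintegral_prod_sGraphon π (hWmeas _) (hWsym _)]
  refine tendsto_lintegral_of_dominated_convergence
    (fun x => C ^ Fintype.card W' *
      ∏ w : W', stepDensityIdx π P (↥(nbrW E w)) (fun u => x u.1))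
    (fun n => Finset.measurable_prod _ fun w _ =>
      (measurable_sGraphon π (hWmeas n)).comp (hrestrict w).measurable) (fun n => ?_) ?_ ?_
  · have hle : ∀ w, ∀ᵐ x ∂(Measure.pi fun _ : U => π),
        sGraphon π (Wn n) (↥(nbrW E w)) (fun u => x u.1)
          ≤ C * stepDensityIdx π P (↥(nbrW E w)) (fun u => x u.1) := fun w =>
      (hrestrict w).quasiMeasurePreserving.ae
        (sGraphon_le_of_sumElim (hWmeas n) (hWreg n) (hequiv w).some hloose (hdom n))
    filter_upwards [ae_all_iff.2 hle] with x hx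
    refine (Finset.prod_le_prod' fun w _ => hx w).trans_eq ?_
    rw [Finset.prod_mul_distrib, Finset.prod_const, Finset.card_univ]
  · have hmeas : Measurable fun x : U → J =>
        ∏ w : W', stepDensityIdx π P (↥(nbrW E w)) (fun u => x u.1) :=
      Finset.measurable_prod _ fun w _ =>
        (measurable_stepDensityIdx π P).comp (hrestrict w).measurable
    rw [lintegral_const_mul _ hmeas]
    exact ENNReal.mul_ne_top (ENNReal.pow_ne_top hC) hfin.ne
  · have hlim : ∀ w, ∀ᵐ x ∂(Measure.pi fun _ : U => π),
        Tendsto (fun n => sGraphon π (Wn n) (↥(nbrW E w)) (fun u => x u.1)) atTop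
          (nhds (stepDensityIdx π P (↥(nbrW E w)) (fun u => x u.1))) := fun w =>
      (hrestrict w).quasiMeasurePreserving.ae
        (tendsto_sGraphon_of_sumElim hWmeas hWreg (hequiv w).some hloose hC hdom hae)
    have hlt : ∀ w, ∀ᵐ x ∂(Measure.pi fun _ : U => π),
        stepDensityIdx π P (↥(nbrW E w)) (fun u => x u.1) < ⊤ := fun w =>
      (hrestrict w).quasiMeasurePreserving.ae (Measure.rnDeriv_lt_top _ _)
    filter_upwards [ae_all_iff.2 hlim, ae_all_iff.2 hlt] with x hx hx'
    exact ENNReal.tendsto_finsetProd_of_ne_top _ (fun w _ => hx w) fun w _ => (hx' w).ne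
end
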